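/- arXiv:1506.04623 — 7 statements merged into one kernel-verified Lean document; each statement's English description precedes it below -/
import Mathlib

section
/- Let c ∈ ℝ³, δ > 0, and let x ∈ ℝ³ satisfy ‖x − c‖ < δ. Then the Newtonian potential of the ball B(c, δ) with kernel g₀ satisfies ∫_{y ∈ B(c,δ)} 1/(4π‖x − y‖) dy = δ²/2 − ‖x − c‖²/6. -/
open MeasureTheory Metric Real

theorem exists_linearIsometryEquiv_prodL2_map_eq
    {E : Type*} [NormedAddCommGroup E] [InnerProductSpace ℝ E] [FiniteDimensional ℝ E]
    (hE : Module.finrank ℝ E = 3) (a : E) :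
    ∃ L : E ≃ₗᵢ[ℝ] WithLp 2 (ℝ × ℂ), L a = WithLp.toLp 2 (‖a‖, 0) := by
  have hP : Module.finrank ℝ (WithLp 2 (ℝ × ℂ)) = 3 := by
    rw [(WithLp.linearEquiv 2 ℝ (ℝ × ℂ)).finrank_eq]
    simp
  let L₀ : E ≃ₗᵢ[ℝ] WithLp 2 (ℝ × ℂ) :=
    (stdOrthonormalBasis ℝ E).equiv (stdOrthonormalBasis ℝ (WithLp 2 (ℝ × ℂ)))
      (finCongr (hE.trans hP.symm))
  have h : ‖L₀ a‖ = ‖(WithLp.toLp 2 (‖a‖, 0) : WithLp 2 (ℝ × ℂ))‖ := by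
    rw [L₀.norm_map, WithLp.prod_norm_eq_of_L2]
    simp
  exact ⟨L₀.trans (Submodule.reflection (ℝ ∙ (L₀ a - WithLp.toLp 2 (‖a‖, 0)))ᗮ),
    Submodule.reflection_sub h⟩

theorem integrableOn_ball_one_div_norm_sub (x : EuclideanSpace ℝ (Fin 3)) (R : ℝ) :
    IntegrableOn (fun y ↦ 1 / (4 * π * ‖x - y‖)) (ball x R) := by
  have h : IntegrableOn (fun y : EuclideanSpace ℝ (Fin 3) ↦ 1 / (4 * π * ‖y‖)) (ball 0 R) := by
    refine (integrableOn_fun_norm_addHaar volume (f := fun r ↦ 1 / (4 * π * r))).2 ?_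
    have hc : IntegrableOn (fun r : ℝ ↦ r / (4 * π)) (Set.Ioo 0 R) :=
      (Continuous.integrableOn_Icc (by fun_prop)).mono_set Set.Ioo_subset_Icc_self
    refine hc.congr_fun (fun r hr ↦ ?_) measurableSet_Ioo
    have : r ≠ 0 := hr.1.ne'
    simp only [finrank_euclideanSpace, Fintype.card_fin, smul_eq_mul]
    field_simp
  have h' := ((measurePreserving_sub_right volume x).integrableOn_comp_preimage
    (MeasurableEquiv.subRight x).measurableEmbedding).2 h
  convert h' using 1
  · ext y
    simp [norm_sub_rev x y]
  · ext y
    simp [dist_eq_norm]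

theorem hasDerivAt_sqrt_sq_add_sq {u r : ℝ} (hr : 0 < r) :
    HasDerivAt (fun r ↦ √(u ^ 2 + r ^ 2)) (r / √(u ^ 2 + r ^ 2)) r := by
  have h : HasDerivAt (fun r : ℝ ↦ u ^ 2 + r ^ 2) (2 * r) r := by
    simpa using (hasDerivAt_pow 2 r).const_add (u ^ 2)
  convert h.sqrt (by positivity) using 1
  field_simp

theorem integral_div_sqrt_sq_add_sq (u : ℝ) {R : ℝ} (hR : 0 ≤ R) :
    ∫ r in 0..R, r / √(u ^ 2 + r ^ 2) = √(u ^ 2 + R ^ 2) - |u| := by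
  have hcont : ContinuousOn (fun r ↦ √(u ^ 2 + r ^ 2)) (Set.Icc 0 R) := by fun_prop
  rw [intervalIntegral.integral_eq_sub_of_hasDerivAt_of_le hR hcont
    (fun r hr ↦ hasDerivAt_sqrt_sq_add_sq hr.1)]
  · simp [sqrt_sq_eq_abs]
  · rw [intervalIntegrable_iff_integrableOn_Ioc_of_le hR]
    exact intervalIntegral.integrableOn_deriv_of_nonneg hcont
      (fun r hr ↦ hasDerivAt_sqrt_sq_add_sq hr.1)
      fun r hr ↦ div_nonneg hr.1.le (sqrt_nonneg _)

/-- Integral of the Coulomb kernel over a planar disc at height `u` above the pole. -/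
theorem integral_disc_one_div_sqrt (u t : ℝ) :
    ∫ w : ℂ, (if ‖w‖ ^ 2 < t then 1 / (4 * π * √(u ^ 2 + ‖w‖ ^ 2)) else 0) =
      if 0 < t then (√(u ^ 2 + t) - |u|) / 2 else 0 := by
  split_ifs with ht
  · rw [integral_fun_norm_addHaar volume
      (fun r ↦ if r ^ 2 < t then 1 / (4 * π * √(u ^ 2 + r ^ 2)) else 0)]
    have key : ∫ r in Set.Ioi (0 : ℝ), r ^ (Module.finrank ℝ ℂ - 1) •
        (if r ^ 2 < t then 1 / (4 * π * √(u ^ 2 + r ^ 2)) else 0) =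
        (4 * π)⁻¹ * (√(u ^ 2 + t) - |u|) := by
      have hi := integral_div_sqrt_sq_add_sq u (sqrt_nonneg t)
      rw [sq_sqrt ht.le] at hi
      rw [← hi, intervalIntegral.integral_of_le (sqrt_nonneg t), integral_Ioc_eq_integral_Ioo,
        ← integral_const_mul, ← integral_indicator measurableSet_Ioi,
        ← integral_indicator measurableSet_Ioo]
      congr 1
      ext r
      by_cases hr : 0 < r
      · by_cases hrt : r ^ 2 < t
        · have : r < √t := lt_sqrt_of_sq_lt hrt
          simp only [Set.indicator, Set.mem_Ioi, Set.mem_Ioo, hr, hrt, this, and_self, if_true,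
            Complex.finrank_real_complex, smul_eq_mul]
          field_simp
          simp
        · have : ¬ r < √t := fun h ↦ hrt ((lt_sqrt hr.le).1 h)
          simp [Set.indicator, hrt, this]
      · simp [Set.indicator, hr]
    rw [key]
    simp only [Measure.real, Complex.volume_ball, Complex.finrank_real_complex]
    simp
    field_simp
    norm_num
  · have : ∀ w : ℂ, ¬ ‖w‖ ^ 2 < t := fun w h ↦ ht ((sq_nonneg _).trans_lt h)
    simp [this]

theorem integral_abs_of_nonpos_of_nonneg {a b : ℝ} (ha : a ≤ 0) (hb : 0 ≤ b) :
    ∫ u in a..b, |u| = (a ^ 2 + b ^ 2) / 2 := by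
  rw [← intervalIntegral.integral_add_adjacent_intervals (b := 0)
    (continuous_abs.intervalIntegrable _ _) (continuous_abs.intervalIntegrable _ _)]
  have h₁ : ∫ u in a..0, |u| = ∫ u in a..0, -u :=
    intervalIntegral.integral_congr fun u hu ↦ abs_of_nonpos (by
      rw [Set.uIcc_of_le ha] at hu; exact hu.2)
  have h₂ : ∫ u in (0 : ℝ)..b, |u| = ∫ u in (0 : ℝ)..b, u :=
    intervalIntegral.integral_congr fun u hu ↦ abs_of_nonneg (by
      rw [Set.uIcc_of_le hb] at hu; exact hu.1)
  rw [h₁, h₂, intervalIntegral.integral_neg, integral_id, integral_id]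
  ring

theorem integral_sqrt_sq_sub_sq_add {s δ : ℝ} (hs : 0 ≤ s) (hsδ : s < δ) :
    ∫ u in (s - δ)..(s + δ), √(δ ^ 2 - s ^ 2 + 2 * s * u) = 2 * δ ^ 2 + 2 * s ^ 2 / 3 := by
  have hδ : 0 ≤ δ := hs.trans hsδ.le
  rcases hs.eq_or_lt with rfl | hs
  · simp [sqrt_sq hδ]
    ring
  have hv : ∀ u ∈ Set.uIcc (s - δ) (s + δ), 0 < δ ^ 2 - s ^ 2 + 2 * s * u := by
    intro u hu
    rw [Set.uIcc_of_le (by linarith)] at hu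
    nlinarith [mul_le_mul_of_nonneg_left hu.1 hs.le, pow_pos (sub_pos.2 hsδ) 2]
  have hd : ∀ u ∈ Set.uIcc (s - δ) (s + δ), HasDerivAt
      (fun u ↦ (δ ^ 2 - s ^ 2 + 2 * s * u) * √(δ ^ 2 - s ^ 2 + 2 * s * u) / (3 * s))
      (√(δ ^ 2 - s ^ 2 + 2 * s * u)) u := by
    intro u hu
    have h : HasDerivAt (fun u : ℝ ↦ δ ^ 2 - s ^ 2 + 2 * s * u) (2 * s) u := by
      simpa using ((hasDerivAt_id u).const_mul (2 * s)).const_add (δ ^ 2 - s ^ 2)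
    refine ((h.mul (h.sqrt (hv u hu).ne')).div_const (3 * s)).congr_deriv ?_
    have hpos := sqrt_pos.2 (hv u hu)
    have hsq := sq_sqrt (hv u hu).le
    set q := √(δ ^ 2 - s ^ 2 + 2 * s * u)
    rw [← hsq]
    field_simp
    ring
  rw [intervalIntegral.integral_eq_sub_of_hasDerivAt hd
    (Continuous.intervalIntegrable (by fun_prop) _ _)]
  have e₁ : δ ^ 2 - s ^ 2 + 2 * s * (s + δ) = (δ + s) ^ 2 := by ring
  have e₂ : δ ^ 2 - s ^ 2 + 2 * s * (s - δ) = (δ - s) ^ 2 := by ring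
  simp only [e₁, e₂]
  rw [sqrt_sq (by linarith), sqrt_sq (by linarith)]
  field_simp
  ring

theorem integral_prod_coulomb {s δ : ℝ} (hs : 0 ≤ s) (hsδ : s < δ)
    (hf : Integrable fun q : ℝ × ℂ ↦ if ‖q.2‖ ^ 2 < δ ^ 2 - (q.1 - s) ^ 2 then
      1 / (4 * π * √(q.1 ^ 2 + ‖q.2‖ ^ 2)) else 0) :
    ∫ q : ℝ × ℂ, (if ‖q.2‖ ^ 2 < δ ^ 2 - (q.1 - s) ^ 2 then
      1 / (4 * π * √(q.1 ^ 2 + ‖q.2‖ ^ 2)) else 0) = δ ^ 2 / 2 - s ^ 2 / 6 := by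
  have hδ : 0 ≤ δ := hs.trans hsδ.le
  rw [Measure.volume_eq_prod] at hf ⊢
  rw [integral_prod _ hf]
  simp only [integral_disc_one_div_sqrt]
  calc _ = ∫ u in Set.Ioo (s - δ) (s + δ), (√(δ ^ 2 - s ^ 2 + 2 * s * u) - |u|) / 2 := by
        rw [← integral_indicator measurableSet_Ioo]
        congr 1
        ext u
        have hu : 0 < δ ^ 2 - (u - s) ^ 2 ↔ u ∈ Set.Ioo (s - δ) (s + δ) := by
          rw [sub_pos, sq_lt_sq, abs_of_nonneg hδ, abs_lt, Set.mem_Ioo]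
          constructor <;> rintro ⟨h₁, h₂⟩ <;> constructor <;> linarith
        simp only [Set.indicator, hu]
        rw [show u ^ 2 + (δ ^ 2 - (u - s) ^ 2) = δ ^ 2 - s ^ 2 + 2 * s * u by ring]
    _ = _ := by
        rw [← integral_Ioc_eq_integral_Ioo, ← intervalIntegral.integral_of_le (by linarith),
          intervalIntegral.integral_div, intervalIntegral.integral_sub
            (Continuous.intervalIntegrable (by fun_prop) _ _)
            (continuous_abs.intervalIntegrable _ _),
          integral_sqrt_sq_sub_sq_add hs hsδ,
          integral_abs_of_nonpos_of_nonneg (by linarith) (by linarith)]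
        ring

theorem newtonian_potential_ball_interior
    (c : EuclideanSpace ℝ (Fin 3)) (δ : ℝ) (hδ : 0 < δ)
    (x : EuclideanSpace ℝ (Fin 3)) (hx : ‖x - c‖ < δ) :
    ∫ y in Metric.ball c δ, 1 / (4 * π * ‖x - y‖) = δ ^ 2 / 2 - ‖x - c‖ ^ 2 / 6 := by
  obtain ⟨L, hL⟩ := exists_linearIsometryEquiv_prodL2_map_eq (by simp) (c - x)
  rw [norm_sub_rev c x] at hL
  set s := ‖x - c‖
  let e : EuclideanSpace ℝ (Fin 3) ≃ᵐ ℝ × ℂ :=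
    (MeasurableEquiv.subRight x).trans
      (L.toMeasurableEquiv.trans (MeasurableEquiv.toLp 2 (ℝ × ℂ)).symm)
  have he : MeasurePreserving e :=
    ((WithLp.volume_preserving_ofLp ℝ ℂ).comp L.measurePreserving).comp
      (measurePreserving_sub_right volume x)
  have hsub : ball c δ ⊆ ball x (δ + δ) := fun y hy ↦ by
    have h := dist_triangle y c x
    rw [dist_comm c x, dist_eq_norm x c] at h
    exact h.trans_lt (add_lt_add hy hx)
  have hf := (integrableOn_ball_one_div_norm_sub x (δ + δ)).mono_set hsub
  rw [← integrable_indicator_iff measurableSet_ball] at hf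
  let G : ℝ × ℂ → ℝ := fun q ↦ if ‖q.2‖ ^ 2 < δ ^ 2 - (q.1 - s) ^ 2 then
    1 / (4 * π * √(q.1 ^ 2 + ‖q.2‖ ^ 2)) else 0
  have hG : (ball c δ).indicator (fun y ↦ 1 / (4 * π * ‖x - y‖)) = G ∘ e := by
    ext y
    have h₁ : ‖x - y‖ = √((e y).1 ^ 2 + ‖(e y).2‖ ^ 2) := by
      rw [norm_sub_rev, ← L.norm_map, WithLp.prod_norm_eq_of_L2, norm_eq_abs, sq_abs]
      rfl
    have h₂ : dist y c ^ 2 = ((e y).1 - s) ^ 2 + ‖(e y).2‖ ^ 2 := by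
      rw [dist_eq_norm, ← sub_sub_sub_cancel_right y c x, ← L.norm_map, map_sub, hL,
        WithLp.prod_norm_sq_eq_of_L2, norm_eq_abs, sq_abs, WithLp.sub_snd, WithLp.sub_fst]
      change ((e y).1 - s) ^ 2 + ‖(e y).2 - 0‖ ^ 2 = _
      rw [sub_zero]
    have h₃ : y ∈ ball c δ ↔ ‖(e y).2‖ ^ 2 < δ ^ 2 - ((e y).1 - s) ^ 2 := by
      rw [mem_ball, ← sq_lt_sq₀ dist_nonneg hδ.le, h₂, lt_sub_iff_add_lt']
    simp only [Set.indicator, h₃, h₁, G, Function.comp_apply]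
  rw [hG, he.integrable_comp_emb e.measurableEmbedding] at hf
  rw [← integral_indicator measurableSet_ball, hG]
  exact (he.integral_comp e.measurableEmbedding G).trans
    (integral_prod_coulomb (norm_nonneg _) hx hf)
end

section
/- Let c ∈ ℝ³ and δ > 0, and define u(x) = ∫_{y ∈ B(c,δ)} 1/(4π‖x − y‖) dy. Then u is twice differentiable at every x with ‖x − c‖ < δ, and its second Fréchet derivative there is the constant bilinear map (v, w) ↦ −⟨v, w⟩/3; that is, ∇∇∫_{B(c,δ)} g₀(x − y) dy = −(1/3)·I, identifying the L-dyadic of a spherical exclusion volume as L = (1/3)·I. -/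
open MeasureTheory Metric Real RealInnerProductSpace

section Polar

variable {E : Type*} [NormedAddCommGroup E] [MeasurableSpace E] [BorelSpace E]

/-- Integration in polar coordinates for nonnegative functions. -/
lemma lintegral_eq_lintegral_toSphere_lintegral_volumeIoiPow [NormedSpace ℝ E]
    [FiniteDimensional ℝ E] [Nontrivial E]
    (μ : Measure E) [μ.IsAddHaarMeasure] {f : E → ENNReal} (hf : Measurable f) :
    ∫⁻ x, f x ∂μ = ∫⁻ ω : sphere (0 : E) 1, ∫⁻ r : Set.Ioi (0 : ℝ), f (r.1 • ω.1)
      ∂(Measure.volumeIoiPow (Module.finrank ℝ E - 1)) ∂μ.toSphere := by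
  have hm : Measurable fun p : sphere (0 : E) 1 × Set.Ioi (0 : ℝ) ↦ f (p.2.1 • p.1.1) := by
    fun_prop
  rw [← lintegral_prod _ hm.aemeasurable,
    ← (μ.measurePreserving_homeomorphUnitSphereProd).lintegral_comp hm]
  conv_lhs => rw [← restrict_compl_singleton (μ := μ) 0,
    ← lintegral_subtype_comap (measurableSet_singleton _).compl]
  refine lintegral_congr fun x ↦ ?_
  have hx : ‖x.1‖ ≠ 0 := norm_ne_zero_iff.2 x.2
  simp [smul_smul, hx]

lemma lintegral_ofReal_inv_mul_volumeIoiPow_succ (n : ℕ) (f : Set.Ioi (0 : ℝ) → ENNReal)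
    (hf : Measurable f) :
    ∫⁻ r, ENNReal.ofReal r.1⁻¹ * f r ∂(Measure.volumeIoiPow (n + 1)) =
      ∫⁻ r, f r ∂(Measure.volumeIoiPow n) := by
  unfold Measure.volumeIoiPow
  rw [lintegral_withDensity_eq_lintegral_mul _ (by fun_prop) (by fun_prop),
    lintegral_withDensity_eq_lintegral_mul _ (by fun_prop) hf]
  refine lintegral_congr fun r ↦ ?_
  have hr : 0 < r.1 := r.2
  simp only [Pi.mul_apply]
  rw [← mul_assoc, ← ENNReal.ofReal_mul (by positivity)]
  congr 2
  field_simp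
  ring

variable [InnerProductSpace ℝ E] [FiniteDimensional ℝ E] [Nontrivial E]

lemma setLIntegral_ball_normalize_eq_lintegral_toSphere {f : E → ENNReal} (hf : Measurable f) :
    ∫⁻ x in ball (0 : E) 1, f (‖x‖⁻¹ • x) =
      Measure.volumeIoiPow (Module.finrank ℝ E - 1) (Set.Iio ⟨1, Set.mem_Ioi.2 one_pos⟩) *
        ∫⁻ ω : sphere (0 : E) 1, f ω.1 ∂(volume : Measure E).toSphere := by
  rw [← lintegral_indicator measurableSet_ball,
    lintegral_eq_lintegral_toSphere_lintegral_volumeIoiPow volume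
      ((by fun_prop : Measurable fun x : E ↦ f (‖x‖⁻¹ • x)).indicator measurableSet_ball),
    ← lintegral_const_mul _ (by fun_prop)]
  refine lintegral_congr fun ω ↦ ?_
  rw [mul_comm, ← setLIntegral_const, ← lintegral_indicator measurableSet_Iio]
  refine lintegral_congr fun r ↦ ?_
  have hr : 0 < r.1 := r.2
  have hω : ‖ω.1‖ = 1 := by simp
  simp [Set.indicator, norm_smul, hω, abs_of_pos hr, smul_smul, hr.ne', ← Subtype.coe_lt_coe]

/-- The surface measure on the unit sphere is invariant under linear isometries. -/
lemma lintegral_toSphere_linearIsometryEquiv (L : E ≃ₗᵢ[ℝ] E) {f : E → ENNReal}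
    (hf : Measurable f) :
    ∫⁻ ω : sphere (0 : E) 1, f (L ω.1) ∂(volume : Measure E).toSphere =
      ∫⁻ ω : sphere (0 : E) 1, f ω.1 ∂(volume : Measure E).toSphere := by
  have hL : Measurable L := L.continuous.measurable
  have h1 := setLIntegral_ball_normalize_eq_lintegral_toSphere (hf.comp hL)
  have h2 := setLIntegral_ball_normalize_eq_lintegral_toSphere hf
  have h3 := L.measurePreserving.setLIntegral_comp_preimage (measurableSet_ball (x := 0) (ε := 1))
    (by fun_prop : Measurable fun x : E ↦ f (‖x‖⁻¹ • x))
  simp only [LinearIsometryEquiv.norm_map, LinearIsometryEquiv.preimage_ball, map_zero] at h3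
  simp only [Function.comp_apply, map_smul] at h1
  rw [h1, h2] at h3
  refine (ENNReal.mul_right_inj ?_ ?_).1 h3
  · rw [Measure.volumeIoiPow_apply_Iio]
    simp; positivity
  · rw [Measure.volumeIoiPow_apply_Iio]
    exact ENNReal.ofReal_ne_top

/-- The second moment of a linear functional over the unit sphere. -/
lemma finrank_mul_lintegral_toSphere_inner_sq (a : E) :
    Module.finrank ℝ E * ∫⁻ ω : sphere (0 : E) 1, ENNReal.ofReal (⟪a, ω.1⟫ ^ 2)
      ∂(volume : Measure E).toSphere =
    ENNReal.ofReal (‖a‖ ^ 2) * (volume : Measure E).toSphere Set.univ := by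
  let b := stdOrthonormalBasis ℝ E
  have key (i) : ∫⁻ ω : sphere (0 : E) 1, ENNReal.ofReal (⟪a, ω.1⟫ ^ 2)
      ∂(volume : Measure E).toSphere =
      ∫⁻ ω : sphere (0 : E) 1, ENNReal.ofReal (⟪‖a‖ • b i, ω.1⟫ ^ 2)
      ∂(volume : Measure E).toSphere := by
    let L : E ≃ₗᵢ[ℝ] E := (ℝ ∙ (a - ‖a‖ • b i))ᗮ.reflection
    have hL : L a = ‖a‖ • b i := Submodule.reflection_sub (by simp [norm_smul])
    rw [← hL, ← lintegral_toSphere_linearIsometryEquiv L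
      (f := fun ω ↦ ENNReal.ofReal (⟪L a, ω⟫ ^ 2)) (by fun_prop)]
    simp
  calc _ = ∑ i, ∫⁻ ω : sphere (0 : E) 1, ENNReal.ofReal (⟪‖a‖ • b i, ω.1⟫ ^ 2)
      ∂(volume : Measure E).toSphere := by
        simp [← key]
    _ = ∫⁻ ω : sphere (0 : E) 1, ENNReal.ofReal (‖a‖ ^ 2) ∂(volume : Measure E).toSphere := by
        rw [← lintegral_finsetSum _ (by fun_prop)]
        refine lintegral_congr fun ω ↦ ?_
        rw [← ENNReal.ofReal_sum_of_nonneg (fun _ _ ↦ sq_nonneg _)]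
        have := b.sum_sq_norm_inner_right ω.1
        simp only [Real.norm_eq_abs, sq_abs] at this
        simp [inner_smul_left, mul_pow, ← Finset.mul_sum, this]
    _ = _ := by simp

end Polar

lemma norm_sub_smul_lt_iff {E : Type*} [NormedAddCommGroup E] [InnerProductSpace ℝ E]
    {a ω : E} {δ r : ℝ} (hω : ‖ω‖ = 1) (ha : ‖a‖ < δ) (hr : 0 < r) :
    ‖a - r • ω‖ < δ ↔ r < ⟪a, ω⟫ + √(⟪a, ω⟫ ^ 2 + δ ^ 2 - ‖a‖ ^ 2) := by
  have hδ : 0 < δ := (norm_nonneg a).trans_lt ha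
  have hD : 0 < δ ^ 2 - ‖a‖ ^ 2 := by nlinarith [norm_nonneg a]
  rw [← sq_lt_sq₀ (norm_nonneg _) hδ.le, norm_sub_sq_real, inner_smul_right, norm_smul, hω]
  simp only [Real.norm_eq_abs, mul_one, sq_abs]
  set s := √(⟪a, ω⟫ ^ 2 + δ ^ 2 - ‖a‖ ^ 2)
  have hs : s ^ 2 = ⟪a, ω⟫ ^ 2 + δ ^ 2 - ‖a‖ ^ 2 := Real.sq_sqrt (by nlinarith)
  have hs0 : 0 ≤ s := Real.sqrt_nonneg _
  have h1 : |⟪a, ω⟫| < s := abs_lt_of_sq_lt_sq (by linarith) hs0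
  have h2 := abs_lt.1 h1
  constructor
  · intro h
    by_contra! hc
    nlinarith
  · intro h
    nlinarith

local notation "V" => EuclideanSpace ℝ (Fin 3)

lemma toSphere_univ_euclideanSpace_fin_three :
    (volume : Measure V).toSphere Set.univ = ENNReal.ofReal (4 * π) := by
  rw [Measure.toSphere_apply_univ, EuclideanSpace.volume_ball_fin_three]
  simp only [finrank_euclideanSpace, Fintype.card_fin]
  rw [← ENNReal.ofReal_natCast, ← ENNReal.ofReal_pow (by norm_num),
    ← ENNReal.ofReal_mul (by positivity), ← ENNReal.ofReal_mul (by positivity)]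
  congr 1
  push_cast
  ring

lemma lintegral_newtonian_kernel_ball_eq_lintegral_toSphere {a : V} {δ : ℝ} (ha : ‖a‖ < δ) :
    ∫⁻ z in ball a δ, ENNReal.ofReal (1 / (4 * π * ‖z‖)) =
      ∫⁻ ω : sphere (0 : V) 1, ENNReal.ofReal
        ((⟪a, ω.1⟫ + √(⟪a, ω.1⟫ ^ 2 + δ ^ 2 - ‖a‖ ^ 2)) ^ 2 / (8 * π))
        ∂(volume : Measure V).toSphere := by
  have hδ : 0 < δ := (norm_nonneg a).trans_lt ha
  rw [← lintegral_indicator measurableSet_ball,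
    lintegral_eq_lintegral_toSphere_lintegral_volumeIoiPow volume
      ((by fun_prop : Measurable fun z : V ↦ ENNReal.ofReal (1 / (4 * π * ‖z‖))).indicator
        measurableSet_ball)]
  refine lintegral_congr fun ω ↦ ?_
  have hω : ‖ω.1‖ = 1 := by simp
  set R := ⟪a, ω.1⟫ + √(⟪a, ω.1⟫ ^ 2 + δ ^ 2 - ‖a‖ ^ 2) with hR
  have hR0 : 0 < R := by
    have : |⟪a, ω.1⟫| < √(⟪a, ω.1⟫ ^ 2 + δ ^ 2 - ‖a‖ ^ 2) := by
      rw [← Real.sqrt_sq_eq_abs]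
      exact Real.sqrt_lt_sqrt (sq_nonneg _) (by nlinarith [norm_nonneg a])
    linarith [(abs_lt.1 this).1]
  have hdim : Module.finrank ℝ V - 1 = 1 + 1 := by simp
  calc
    _ = ∫⁻ r : Set.Ioi (0 : ℝ), ENNReal.ofReal r.1⁻¹ *
          (Set.Iio ⟨R, hR0⟩).indicator (fun _ ↦ ENNReal.ofReal (1 / (4 * π))) r
        ∂(Measure.volumeIoiPow (1 + 1)) := by
      rw [hdim]
      refine lintegral_congr fun r ↦ ?_
      have hr : 0 < r.1 := r.2
      have := norm_sub_smul_lt_iff hω ha hr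
      rw [← hR, norm_sub_rev] at this
      simp only [Set.indicator, mem_ball, dist_eq_norm, this, Set.mem_Iio, ← Subtype.coe_lt_coe]
      split_ifs
      · rw [← ENNReal.ofReal_mul (by positivity), norm_smul, hω, Real.norm_of_nonneg hr.le]
        congr 1
        field_simp
      · simp
    _ = _ := by
      rw [lintegral_ofReal_inv_mul_volumeIoiPow_succ _ _
          (measurable_const.indicator measurableSet_Iio),
        lintegral_indicator measurableSet_Iio, setLIntegral_const,
        Measure.volumeIoiPow_apply_Iio, ← ENNReal.ofReal_mul (by positivity)]
      congr 1
      push_cast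
      field_simp
      ring

lemma lintegral_newtonian_kernel_ball {a : V} {δ : ℝ} (ha : ‖a‖ < δ) :
    ∫⁻ z in ball a δ, ENNReal.ofReal (1 / (4 * π * ‖z‖)) =
      ENNReal.ofReal (δ ^ 2 / 2 - ‖a‖ ^ 2 / 6) := by
  have hδ : 0 < δ := (norm_nonneg a).trans_lt ha
  have hD : 0 < δ ^ 2 - ‖a‖ ^ 2 := by nlinarith [norm_nonneg a]
  have hpos := lintegral_newtonian_kernel_ball_eq_lintegral_toSphere ha
  have hneg := hpos
  rw [← lintegral_toSphere_linearIsometryEquiv (LinearIsometryEquiv.neg ℝ)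
    (f := fun ω : V ↦ ENNReal.ofReal
        ((⟪a, ω⟫ + √(⟪a, ω⟫ ^ 2 + δ ^ 2 - ‖a‖ ^ 2)) ^ 2 / (8 * π))) (by fun_prop)] at hneg
  simp only [LinearIsometryEquiv.coe_neg, inner_neg_right, neg_sq] at hneg
  set I := ∫⁻ z in ball a δ, ENNReal.ofReal (1 / (4 * π * ‖z‖))
  have hQ := finrank_mul_lintegral_toSphere_inner_sq a
  rw [toSphere_univ_euclideanSpace_fin_three] at hQ
  simp only [finrank_euclideanSpace, Fintype.card_fin] at hQ
  set Q := ∫⁻ ω : sphere (0 : V) 1, ENNReal.ofReal (⟪a, ω.1⟫ ^ 2) ∂(volume : Measure V).toSphere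
    with hQdef
  have hsum : I + I = ENNReal.ofReal (1 / (2 * π)) * Q +
      ENNReal.ofReal ((δ ^ 2 - ‖a‖ ^ 2) / (4 * π)) * ENNReal.ofReal (4 * π) := by
    nth_rw 1 [hpos]
    rw [hneg, ← lintegral_add_left (by fun_prop), ← toSphere_univ_euclideanSpace_fin_three,
      ← lintegral_const, hQdef, ← lintegral_const_mul _ (by fun_prop),
      ← lintegral_add_left (by fun_prop)]
    refine lintegral_congr fun ω ↦ ?_
    have hs : √(⟪a, ω.1⟫ ^ 2 + δ ^ 2 - ‖a‖ ^ 2) ^ 2 = ⟪a, ω.1⟫ ^ 2 + δ ^ 2 - ‖a‖ ^ 2 :=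
      Real.sq_sqrt (by nlinarith)
    rw [← ENNReal.ofReal_mul (by positivity), ← ENNReal.ofReal_add (by positivity) (by positivity),
      ← ENNReal.ofReal_add (by positivity) (by positivity)]
    congr 1
    field_simp
    linear_combination 16 * hs
  have hQtop : Q ≠ ⊤ := by
    have : (3 : ENNReal) * Q ≠ ⊤ := by
      rw [← Nat.cast_ofNat, hQ]
      finiteness
    exact fun h ↦ this (by simp [h])
  have hItop : I ≠ ⊤ := by
    have : I + I ≠ ⊤ := by
      rw [hsum]
      finiteness
    exact fun h ↦ this (by simp [h])
  have hQ' := congrArg ENNReal.toReal hQ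
  have hsum' := congrArg ENNReal.toReal hsum
  rw [ENNReal.toReal_add hItop hItop, ENNReal.toReal_add
    (ENNReal.mul_ne_top ENNReal.ofReal_ne_top hQtop) (by finiteness)] at hsum'
  simp only [ENNReal.toReal_mul] at hQ' hsum'
  rw [ENNReal.toReal_ofReal (by positivity), ENNReal.toReal_ofReal (by positivity),
    ENNReal.toReal_ofReal (by positivity)] at hsum'
  rw [ENNReal.toReal_ofReal (by positivity), ENNReal.toReal_ofReal (by positivity)] at hQ'
  have hq : Q.toReal = ‖a‖ ^ 2 * (4 * π) / 3 := by
    rw [← hQ']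
    simp
  rw [← ENNReal.ofReal_toReal hItop]
  congr 1
  rw [hq] at hsum'
  field_simp at hsum' ⊢
  linarith

/-- The Newtonian potential of a ball, at interior points. -/
lemma integral_newtonian_kernel_ball {c x : V} {δ : ℝ} (hx : ‖x - c‖ < δ) :
    ∫ y in ball c δ, 1 / (4 * π * ‖x - y‖) = δ ^ 2 / 2 - ‖x - c‖ ^ 2 / 6 := by
  rw [integral_eq_lintegral_of_nonneg_ae (.of_forall fun y ↦ by positivity)
    (by fun_prop : Measurable fun y : V ↦ 1 / (4 * π * ‖x - y‖)).aestronglyMeasurable]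
  have h : ∫⁻ y in ball c δ, ENNReal.ofReal (1 / (4 * π * ‖x - y‖)) =
      ∫⁻ z in ball (x - c) δ, ENNReal.ofReal (1 / (4 * π * ‖z‖)) := by
    rw [← lintegral_indicator measurableSet_ball, ← lintegral_indicator measurableSet_ball,
      ← lintegral_sub_left_eq_self _ x]
    refine lintegral_congr fun y ↦ ?_
    have : ‖x - y - c‖ = ‖y - (x - c)‖ := by
      rw [← norm_neg]
      congr 1
      abel
    simp [Set.indicator, dist_eq_norm, this]
  rw [h, lintegral_newtonian_kernel_ball hx, ENNReal.toReal_ofReal]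
  nlinarith [norm_nonneg (x - c)]

theorem hessian_newtonian_potential_ball_interior
    (c : EuclideanSpace ℝ (Fin 3)) (δ : ℝ) (hδ : 0 < δ)
    (u : EuclideanSpace ℝ (Fin 3) → ℝ)
    (hu : ∀ x, u x = ∫ y in Metric.ball c δ, 1 / (4 * π * ‖x - y‖))
    (x : EuclideanSpace ℝ (Fin 3)) (hx : ‖x - c‖ < δ) :
    DifferentiableAt ℝ u x ∧ DifferentiableAt ℝ (fderiv ℝ u) x ∧
      ∀ v w : EuclideanSpace ℝ (Fin 3),
        fderiv ℝ (fderiv ℝ u) x v w = -⟪v, w⟫ / 3 := by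
  have hmem {y : V} (hy : ‖y - c‖ < δ) : ∀ᶠ z in nhds y, ‖z - c‖ < δ :=
    (by fun_prop : Continuous fun z : V ↦ ‖z - c‖).continuousAt.eventually_lt_const hy
  have hfd {y : V} (hy : ‖y - c‖ < δ) :
      HasFDerivAt u ((-(1 / 3) : ℝ) • innerSL ℝ (y - c)) y := by
    have h1 : HasFDerivAt (fun z : V ↦ δ ^ 2 / 2 - ‖z - c‖ ^ 2 / 6)
        ((-(1 / 3) : ℝ) • innerSL ℝ (y - c)) y := by
      have h := (((hasFDerivAt_id y).sub_const c).norm_sq.const_mul (1 / 6 : ℝ)).const_sub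
        (δ ^ 2 / 2)
      refine (h.congr_of_eventuallyEq (.of_forall fun z ↦ ?_)).congr_fderiv ?_
      · simp only [id]
        ring
      · ext v
        simp
        ring
    exact h1.congr_of_eventuallyEq <| (hmem hy).mono fun z hz ↦ by
      rw [hu, integral_newtonian_kernel_ball hz]
  have hfd2 : HasFDerivAt (fderiv ℝ u) ((-(1 / 3) : ℝ) • innerSL ℝ : V →L[ℝ] V →L[ℝ] ℝ) x := by
    have h1 : HasFDerivAt (fun y : V ↦ (-(1 / 3) : ℝ) • innerSL ℝ (y - c))
        ((-(1 / 3) : ℝ) • innerSL ℝ : V →L[ℝ] V →L[ℝ] ℝ) x :=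
      (((innerSL ℝ).hasFDerivAt (x := x - c)).comp x
        ((hasFDerivAt_id x).sub_const c)).const_smul (-(1 / 3) : ℝ)
    exact h1.congr_of_eventuallyEq <| (hmem hx).mono fun z hz ↦ (hfd hz).fderiv
  refine ⟨(hfd hx).differentiableAt, hfd2.differentiableAt, fun v w ↦ ?_⟩
  rw [hfd2.fderiv]
  simp only [_root_.smul_apply, smul_eq_mul]
  rw [innerSL_apply_apply]
  ring
end

section
/- Let k ∈ ℝ. The regular part g̃(y) = (exp(−i k ‖y‖) − 1)/(4π‖y‖) is twice differentiable at every y ≠ 0, and there exists a constant C > 0 (depending only on k) such that for all y with 0 < ‖y‖ ≤ 1, the second Fréchet derivative satisfies ‖D²g̃(y)‖ ≤ C/‖y‖; in particular, the second derivative of the regular part has only an integrable O(1/R) singularity rather than the O(1/R³) hyper-singularity of the full Green's function. -/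
open MeasureTheory Metric Real

noncomputable def gReg (k : ℝ) (y : EuclideanSpace ℝ (Fin 3)) : ℂ :=
  (Complex.exp (-Complex.I * k * ‖y‖) - 1) / (4 * π * ‖y‖)

section Radial

variable {E F : Type*} [NormedAddCommGroup E] [InnerProductSpace ℝ E]
  [NormedAddCommGroup F] [NormedSpace ℝ F]

theorem hasFDerivAt_norm_of_ne_zero {x : E} (hx : x ≠ 0) :
    HasFDerivAt (fun y : E => ‖y‖) (‖x‖⁻¹ • innerSL ℝ x) x := by
  have hx' : ‖x‖ ≠ 0 := norm_ne_zero_iff.mpr hx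
  have h := (hasStrictFDerivAt_norm_sq x).hasFDerivAt.sqrt (pow_ne_zero 2 hx')
  simp only [Real.sqrt_sq (norm_nonneg _)] at h
  convert h using 1
  ext v
  simp
  field_simp

theorem hasFDerivAt_comp_norm {f : ℝ → F} {f' : F} {x : E} (hx : x ≠ 0)
    (hf : HasDerivAt f f' ‖x‖) :
    HasFDerivAt (fun y : E => f ‖y‖) ((innerSL ℝ x).smulRight (‖x‖⁻¹ • f')) x := by
  refine (hf.hasFDerivAt.comp x (hasFDerivAt_norm_of_ne_zero hx)).congr_fderiv ?_
  ext v
  simp [smul_smul, mul_comm]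

/-- The Hessian of a radial function `f ‖x‖`, where `a` and `b` are the first and second derivatives
of `f` at `‖x‖`. -/
noncomputable def radialHessian (x : E) (a b : F) : E →L[ℝ] E →L[ℝ] F :=
  (ContinuousLinearMap.smulRightL ℝ E F).precompR E (innerSL ℝ x)
      ((innerSL ℝ x).smulRight (‖x‖⁻¹ • (‖x‖⁻¹ • b + (-(‖x‖ ^ 2)⁻¹) • a))) +
    (ContinuousLinearMap.smulRightL ℝ E F).precompL E (innerSL ℝ) (‖x‖⁻¹ • a)

theorem hasFDerivAt_fderiv_comp_norm {f f' : ℝ → F} {f'' : F} {x : E} (hx : x ≠ 0)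
    (hf : ∀ r, 0 < r → HasDerivAt f (f' r) r) (hf' : HasDerivAt f' f'' ‖x‖) :
    HasFDerivAt (fderiv ℝ fun y : E => f ‖y‖) (radialHessian x (f' ‖x‖) f'') x := by
  have hx' : ‖x‖ ≠ 0 := norm_ne_zero_iff.mpr hx
  have hp := hasFDerivAt_comp_norm hx ((hasDerivAt_inv hx').smul hf')
  refine ((ContinuousLinearMap.smulRightL ℝ E F).hasFDerivAt_of_bilinear
    (innerSL ℝ).hasFDerivAt hp).congr_of_eventuallyEq ?_
  filter_upwards [isOpen_ne.mem_nhds hx] with y hy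
  exact (hasFDerivAt_comp_norm hy (hf _ (norm_pos_iff.mpr hy))).fderiv

theorem norm_radialHessian_le {x : E} (hx : x ≠ 0) (a b : F) :
    ‖radialHessian x a b‖ ≤ ‖b‖ + 2 * ‖a‖ / ‖x‖ := by
  have hx' : 0 < ‖x‖ := norm_pos_iff.mpr hx
  refine ContinuousLinearMap.opNorm_le_bound₂ _ (by positivity) fun v w => ?_
  have key : radialHessian x a b v w =
      (inner ℝ x w * inner ℝ x v * (‖x‖ ^ 2)⁻¹) • b +
        (inner ℝ v w * ‖x‖⁻¹ - inner ℝ x w * inner ℝ x v * (‖x‖ ^ 3)⁻¹) • a := by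
    have hvw : innerSL ℝ v w = inner ℝ v w := innerSL_apply_apply ℝ v w
    simp [radialHessian, hvw]
    match_scalars <;> field_simp
    ring
  have h1 : |inner ℝ x w * inner ℝ x v| ≤ ‖x‖ ^ 2 * (‖v‖ * ‖w‖) := by
    rw [abs_mul]
    calc _ ≤ (‖x‖ * ‖w‖) * (‖x‖ * ‖v‖) := by
          gcongr <;> exact abs_real_inner_le_norm _ _
      _ = _ := by ring
  have h2 : |inner ℝ v w| ≤ ‖v‖ * ‖w‖ := abs_real_inner_le_norm v w
  rw [key]
  calc _ ≤ |inner ℝ x w * inner ℝ x v| * (‖x‖ ^ 2)⁻¹ * ‖b‖ +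
        (|inner ℝ v w| * ‖x‖⁻¹ + |inner ℝ x w * inner ℝ x v| * (‖x‖ ^ 3)⁻¹) * ‖a‖ := by
        refine (norm_add_le _ _).trans ?_
        rw [norm_smul, norm_smul, Real.norm_eq_abs, Real.norm_eq_abs, abs_mul _ (‖x‖ ^ 2)⁻¹,
          abs_of_pos (a := (‖x‖ ^ 2)⁻¹) (by positivity)]
        gcongr
        refine (abs_sub _ _).trans_eq ?_
        rw [abs_mul _ ‖x‖⁻¹, abs_mul _ (‖x‖ ^ 3)⁻¹, abs_of_pos (a := ‖x‖⁻¹) (by positivity),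
          abs_of_pos (a := (‖x‖ ^ 3)⁻¹) (by positivity)]
    _ ≤ ‖x‖ ^ 2 * (‖v‖ * ‖w‖) * (‖x‖ ^ 2)⁻¹ * ‖b‖ +
        (‖v‖ * ‖w‖ * ‖x‖⁻¹ + ‖x‖ ^ 2 * (‖v‖ * ‖w‖) * (‖x‖ ^ 3)⁻¹) * ‖a‖ := by gcongr
    _ = _ := by field_simp; ring

end Radial

/-- The entire function `z ↦ (exp (-i k z) - 1) / (4 π z)`, with its removable singularity filled
in. -/
noncomputable def gRegProfile (k : ℝ) : ℂ → ℂ :=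
  dslope (fun z : ℂ => Complex.exp (-Complex.I * k * z) / (4 * π)) 0

theorem differentiable_gRegProfile (k : ℝ) : Differentiable ℂ (gRegProfile k) := by
  rw [← differentiableOn_univ, gRegProfile, Complex.differentiableOn_dslope Filter.univ_mem,
    differentiableOn_univ]
  fun_prop

theorem gReg_eq_gRegProfile (k : ℝ) {y : EuclideanSpace ℝ (Fin 3)} (hy : y ≠ 0) :
    gReg k y = gRegProfile k ‖y‖ := by
  have hy' : (‖y‖ : ℂ) ≠ 0 := by simpa using hy
  rw [gReg, gRegProfile, dslope_of_ne _ hy', slope_def_field]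
  have hpi : (π : ℂ) ≠ 0 := by exact_mod_cast Real.pi_ne_zero
  simp
  field_simp

theorem regular_part_second_derivative_bound (k : ℝ) :
    (∀ y : EuclideanSpace ℝ (Fin 3), y ≠ 0 →
      DifferentiableAt ℝ (gReg k) y ∧ DifferentiableAt ℝ (fderiv ℝ (gReg k)) y) ∧
    ∃ C : ℝ, 0 < C ∧ ∀ y : EuclideanSpace ℝ (Fin 3), 0 < ‖y‖ → ‖y‖ ≤ 1 →
      ‖fderiv ℝ (fderiv ℝ (gReg k)) y‖ ≤ C / ‖y‖ := by
  have hH : Differentiable ℂ (gRegProfile k) := differentiable_gRegProfile k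
  have hH1 : Differentiable ℂ (deriv (gRegProfile k)) :=
    (hH.contDiff (n := 2)).differentiable_deriv_two
  have hH2 : Continuous (deriv (deriv (gRegProfile k))) :=
    (hH1.contDiff (n := 1)).continuous_deriv le_rfl
  have hf (r : ℝ) : HasDerivAt (fun r : ℝ => gRegProfile k r) (deriv (gRegProfile k) r) r :=
    (hH r).hasDerivAt.comp_ofReal
  have hf' (r : ℝ) : HasDerivAt (fun r : ℝ => deriv (gRegProfile k) r)
      (deriv (deriv (gRegProfile k)) r) r :=
    (hH1 r).hasDerivAt.comp_ofReal
  have heq {y : EuclideanSpace ℝ (Fin 3)} (hy : y ≠ 0) :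
      gReg k =ᶠ[nhds y] fun x => gRegProfile k ‖x‖ := by
    filter_upwards [isOpen_ne.mem_nhds hy] with x hx
    exact gReg_eq_gRegProfile k hx
  have hD2 {y : EuclideanSpace ℝ (Fin 3)} (hy : y ≠ 0) :=
    (hasFDerivAt_fderiv_comp_norm hy (fun r _ => hf r) (hf' ‖y‖)).congr_of_eventuallyEq
      (heq hy).fderiv
  refine ⟨fun y hy => ⟨?_, (hD2 hy).differentiableAt⟩, ?_⟩
  · exact ((hasFDerivAt_comp_norm hy (hf ‖y‖)).congr_of_eventuallyEq (heq hy)).differentiableAt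
  obtain ⟨A, hA⟩ := (isCompact_Icc (a := (0 : ℝ)) (b := 1)).exists_bound_of_continuousOn
    (hH1.continuous.comp Complex.continuous_ofReal).continuousOn
  obtain ⟨B, hB⟩ := (isCompact_Icc (a := (0 : ℝ)) (b := 1)).exists_bound_of_continuousOn
    (hH2.comp Complex.continuous_ofReal).continuousOn
  have hA0 : 0 ≤ A := (norm_nonneg _).trans (hA 0 (by simp))
  have hB0 : 0 ≤ B := (norm_nonneg _).trans (hB 0 (by simp))
  refine ⟨B + 2 * A + 1, by positivity, fun y hy hy1 => ?_⟩
  have hy0 : y ≠ 0 := norm_pos_iff.mp hy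
  have hmem : ‖y‖ ∈ Set.Icc (0 : ℝ) 1 := ⟨hy.le, hy1⟩
  rw [(hD2 hy0).fderiv]
  calc _ ≤ ‖deriv (deriv (gRegProfile k)) ‖y‖‖ + 2 * ‖deriv (gRegProfile k) ‖y‖‖ / ‖y‖ :=
        norm_radialHessian_le hy0 _ _
    _ ≤ B / ‖y‖ + 2 * A / ‖y‖ := by
        gcongr
        · exact (hB _ hmem).trans (le_div_self hB0 hy hy1)
        · exact hA _ hmem
    _ ≤ _ := by
        rw [← add_div]
        exact div_le_div_of_nonneg_right (by linarith) hy.le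
end

section
/- Let r ∈ ℝ³, δ > 0, and let F : ℝ³ → ℂ be Lipschitz with constant L on the closed ball of radius δ around r. Then for all unit vectors v, w ∈ ℝ³, the function y ↦ K(y − r)(v, w)·(F(y) − F(r)) is integrable on B(r, δ) and |∫_{B(r,δ)} (3⟨û, v⟩⟨û, w⟩ − ⟨v, w⟩)/(4π‖y − r‖³) · (F(y) − F(r)) dy| ≤ 2·L·δ, where û = (y − r)/‖y − r‖. (This is the correction-term estimate |∫_{V_δ} ∇∇g₀ [ΔεE(r′) − ΔεE(r)]| ≤ C₃‖ΔεE‖_{1,∞} δ.) -/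
open MeasureTheory Metric Real RealInnerProductSpace

/-- The bilinear form `3 ⟨u, v⟩ ⟨u, w⟩ - ⟨v, w⟩` with `u` a unit vector is bounded
by `2` on unit vectors. -/
lemma abs_three_mul_inner_mul_inner_sub_inner_le {E : Type*} [NormedAddCommGroup E]
    [InnerProductSpace ℝ E] {u v w : E} (hu : ‖u‖ = 1) (hv : ‖v‖ = 1) (hw : ‖w‖ = 1) :
    |3 * ⟪u, v⟫ * ⟪u, w⟫ - ⟪v, w⟫| ≤ 2 := by
  have hsq : ‖(3 * ⟪u, v⟫) • u - v‖ ^ 2 = 1 + 3 * ⟪u, v⟫ ^ 2 := by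
    rw [norm_sub_sq_real, norm_smul, real_inner_smul_left, hu, hv, mul_one, Real.norm_eq_abs,
      sq_abs]
    ring
  have hle : ⟪u, v⟫ ^ 2 ≤ 1 := by
    rw [sq_le_one_iff_abs_le_one]
    simpa [hu, hv] using abs_real_inner_le_norm u v
  have hnorm : ‖(3 * ⟪u, v⟫) • u - v‖ ≤ 2 := by
    nlinarith [norm_nonneg ((3 * ⟪u, v⟫) • u - v)]
  have hinner : 3 * ⟪u, v⟫ * ⟪u, w⟫ - ⟪v, w⟫ = ⟪(3 * ⟪u, v⟫) • u - v, w⟫ := by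
    rw [inner_sub_left, real_inner_smul_left]
  rw [hinner]
  calc |⟪(3 * ⟪u, v⟫) • u - v, w⟫| ≤ ‖(3 * ⟪u, v⟫) • u - v‖ * ‖w‖ := abs_real_inner_le_norm _ _
    _ ≤ 2 := by rwa [hw, mul_one]

/-- The hypersingular kernel is bounded by `1 / (2 π ‖y‖ ^ 3)` on unit vectors. -/
lemma abs_hypersingular_kernel_le {E : Type*} [NormedAddCommGroup E] [InnerProductSpace ℝ E]
    (y : E) {v w : E} (hv : ‖v‖ = 1) (hw : ‖w‖ = 1) :
    |(3 * ⟪‖y‖⁻¹ • y, v⟫ * ⟪‖y‖⁻¹ • y, w⟫ - ⟪v, w⟫) / (4 * π * ‖y‖ ^ 3)| ≤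
      1 / (2 * π * ‖y‖ ^ 3) := by
  rcases eq_or_ne y 0 with rfl | hy
  · simp
  have hy' : 0 < ‖y‖ := norm_pos_iff.mpr hy
  have hu : ‖‖y‖⁻¹ • y‖ = 1 := by
    rw [norm_smul, norm_inv, norm_norm, inv_mul_cancel₀ hy'.ne']
  have hden : 0 < 4 * π * ‖y‖ ^ 3 := by positivity
  rw [abs_div, abs_of_pos hden]
  calc _ ≤ 2 / (4 * π * ‖y‖ ^ 3) := by
        gcongr
        exact abs_three_mul_inner_mul_inner_sub_inner_le hu hv hw
    _ = 1 / (2 * π * ‖y‖ ^ 3) := by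
        field_simp
        norm_num

lemma sq_smul_indicator_Iio_div_sq (δ c : ℝ) :
    Set.EqOn (fun t : ℝ => t ^ 2 • (Set.Iio δ).indicator (fun s => c / s ^ 2) t)
      ((Set.Iio δ).indicator fun _ => c) (Set.Ioi 0) := by
  intro t ht
  have ht' : t ≠ 0 := (Set.mem_Ioi.mp ht).ne'
  by_cases h : t ∈ Set.Iio δ
  · simp only [Set.indicator_of_mem h, smul_eq_mul]
    field_simp
  · simp [Set.indicator_of_notMem h]

lemma integrable_indicator_Iio_div_norm_sq (δ c : ℝ) :
    Integrable fun y : EuclideanSpace ℝ (Fin 3) =>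
      (Set.Iio δ).indicator (fun s => c / s ^ 2) ‖y‖ := by
  rw [integrable_fun_norm_addHaar volume (f := (Set.Iio δ).indicator fun s => c / s ^ 2),
    finrank_euclideanSpace_fin]
  refine IntegrableOn.congr_fun ?_ (sq_smul_indicator_Iio_div_sq δ c).symm measurableSet_Ioi
  rw [IntegrableOn, integrable_indicator_iff measurableSet_Iio, IntegrableOn,
    Measure.restrict_restrict measurableSet_Iio, Set.Iio_inter_Ioi]
  exact integrableOn_const (by simp)

lemma integral_indicator_Iio_div_norm_sq {δ : ℝ} (hδ : 0 ≤ δ) (c : ℝ) :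
    ∫ y : EuclideanSpace ℝ (Fin 3), (Set.Iio δ).indicator (fun s => c / s ^ 2) ‖y‖ =
      4 * π * c * δ := by
  have hball : volume.real (ball (0 : EuclideanSpace ℝ (Fin 3)) 1) = 4 / 3 * π := by
    rw [measureReal_def, EuclideanSpace.volume_ball_fin_three]
    simp only [ENNReal.ofReal_one, one_pow, one_mul]
    rw [ENNReal.toReal_ofReal (by positivity)]
    ring
  rw [integral_fun_norm_addHaar volume ((Set.Iio δ).indicator fun s => c / s ^ 2),
    finrank_euclideanSpace_fin, hball,
    setIntegral_congr_fun measurableSet_Ioi (sq_smul_indicator_Iio_div_sq δ c),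
    integral_indicator measurableSet_Iio, Measure.restrict_restrict measurableSet_Iio,
    Set.Iio_inter_Ioi, setIntegral_const]
  simp only [Real.volume_real_Ioo_of_le hδ, smul_eq_mul, nsmul_eq_mul]
  push_cast
  ring

theorem hypersingular_correction_lipschitz_estimate
    (r : EuclideanSpace ℝ (Fin 3)) (δ : ℝ) (hδ : 0 < δ)
    (F : EuclideanSpace ℝ (Fin 3) → ℂ) (L : ℝ)
    (hF : ∀ y ∈ Metric.closedBall r δ, ∀ z ∈ Metric.closedBall r δ,
      ‖F y - F z‖ ≤ L * ‖y - z‖)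
    (v w : EuclideanSpace ℝ (Fin 3)) (hv : ‖v‖ = 1) (hw : ‖w‖ = 1) :
    IntegrableOn
      (fun y => (((3 * ⟪‖y - r‖⁻¹ • (y - r), v⟫ * ⟪‖y - r‖⁻¹ • (y - r), w⟫ - ⟪v, w⟫) /
          (4 * π * ‖y - r‖ ^ 3) : ℝ) : ℂ) * (F y - F r))
      (Metric.ball r δ) volume ∧
    ‖∫ y in Metric.ball r δ,
        (((3 * ⟪‖y - r‖⁻¹ • (y - r), v⟫ * ⟪‖y - r‖⁻¹ • (y - r), w⟫ - ⟪v, w⟫) /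
          (4 * π * ‖y - r‖ ^ 3) : ℝ) : ℂ) * (F y - F r)‖ ≤ 2 * L * δ := by
  set f : EuclideanSpace ℝ (Fin 3) → ℂ := fun y =>
    (((3 * ⟪‖y - r‖⁻¹ • (y - r), v⟫ * ⟪‖y - r‖⁻¹ • (y - r), w⟫ - ⟪v, w⟫) /
      (4 * π * ‖y - r‖ ^ 3) : ℝ) : ℂ) * (F y - F r)
  set g : EuclideanSpace ℝ (Fin 3) → ℝ := fun y =>
    (Set.Iio δ).indicator (fun s => L / (2 * π) / s ^ 2) ‖y - r‖
  have hg : Integrable g :=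
    (integrable_indicator_Iio_div_norm_sq δ (L / (2 * π))).comp_sub_right r
  have hfg : ∀ y ∈ ball r δ, ‖f y‖ ≤ g y := by
    intro y hy
    have hy' : ‖y - r‖ < δ := mem_ball_iff_norm.mp hy
    have hF' := hF y (ball_subset_closedBall hy) r (mem_closedBall_self hδ.le)
    simp only [f, g, Set.indicator_of_mem (Set.mem_Iio.mpr hy'), norm_mul, Complex.norm_real,
      Real.norm_eq_abs]
    rcases eq_or_ne y r with rfl | hne
    · simp
    have hpos : 0 < ‖y - r‖ := norm_pos_iff.mpr (sub_ne_zero.mpr hne)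
    calc _ ≤ 1 / (2 * π * ‖y - r‖ ^ 3) * (L * ‖y - r‖) := by
          gcongr
          exact abs_hypersingular_kernel_le (y - r) hv hw
      _ = L / (2 * π) / ‖y - r‖ ^ 2 := by field_simp
  have hFcont : ContinuousOn F (ball r δ) := by
    refine (LipschitzOnWith.of_dist_le_mul (K := L.toNNReal) fun y hy z hz => ?_).continuousOn
    rw [dist_eq_norm, dist_eq_norm]
    exact (hF y (ball_subset_closedBall hy) z (ball_subset_closedBall hz)).trans
      (mul_le_mul_of_nonneg_right (Real.le_coe_toNNReal L) (norm_nonneg _))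
  have hfmeas : AEStronglyMeasurable f (volume.restrict (ball r δ)) := by
    refine AEStronglyMeasurable.mul ?_
      ((hFcont.aestronglyMeasurable measurableSet_ball).sub aestronglyMeasurable_const)
    exact Measurable.aestronglyMeasurable (by fun_prop)
  have hae : ∀ᵐ y ∂volume.restrict (ball r δ), ‖f y‖ ≤ g y :=
    ae_restrict_of_forall_mem measurableSet_ball hfg
  refine ⟨hg.integrableOn.mono' hfmeas hae, ?_⟩
  calc ‖∫ y in ball r δ, f y‖ ≤ ∫ y in ball r δ, g y :=
        norm_integral_le_of_norm_le hg.integrableOn hae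
    _ = ∫ y, g y := by
        refine setIntegral_eq_integral_of_forall_compl_eq_zero fun y hy => ?_
        have hy' : ‖y - r‖ ∉ Set.Iio δ := fun h => hy (mem_ball_iff_norm.mpr h)
        simp only [g, Set.indicator_of_notMem hy']
    _ = 4 * π * (L / (2 * π)) * δ :=
        (integral_sub_right_eq_self _ r).trans (integral_indicator_Iio_div_norm_sq hδ.le _)
    _ = 2 * L * δ := by
        field_simp
        ring
end

section
/- Let r ∈ ℝ³, δ > 0, and let F : ℝ³ → ℂ be twice continuously differentiable on a neighborhood of the closed ball of radius δ around r, with ‖D²F(y)‖ ≤ M₂ there. Then for all unit vectors v, w ∈ ℝ³, |∫_{B(r,δ)} (3⟨û, v⟩⟨û, w⟩ − ⟨v, w⟩)/(4π‖y − r‖³) · (F(y) − F(r)) dy| ≤ (1/2)·M₂·δ², where û = (y − r)/‖y − r‖; i.e., for a spherical exclusion volume centered at the singularity, the anti-symmetry of ∇∇g₀ improves the O(δ) correction estimate to O(δ²). -/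
open MeasureTheory Metric Real RealInnerProductSpace

/-- The bilinear form `3 u ⊗ u - I` at a unit vector has norm at most two. -/
lemma abs_three_mul_inner_mul_inner_sub_le {E : Type*} [NormedAddCommGroup E]
    [InnerProductSpace ℝ E] {u : E} (hu : ‖u‖ = 1) (v w : E) :
    |3 * ⟪u, v⟫ * ⟪u, w⟫ - ⟪v, w⟫| ≤ 2 * (‖v‖ * ‖w‖) := by
  have hreflect : ‖(2 * ⟪u, v⟫) • u - v‖ = ‖v‖ := by
    rw [← sq_eq_sq₀ (norm_nonneg _) (norm_nonneg _), @norm_sub_sq ℝ, norm_smul, inner_smul_left,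
      hu, mul_one, Real.norm_eq_abs, sq_abs]
    simp
    ring
  have h₁ : |⟪(2 * ⟪u, v⟫) • u - v, w⟫| ≤ ‖v‖ * ‖w‖ := by
    simpa only [hreflect] using abs_real_inner_le_norm ((2 * ⟪u, v⟫) • u - v) w
  have h₂ : |⟪u, v⟫ * ⟪u, w⟫| ≤ ‖v‖ * ‖w‖ := by
    rw [abs_mul]
    have hv := abs_real_inner_le_norm u v
    have hw := abs_real_inner_le_norm u w
    rw [hu, one_mul] at hv hw
    gcongr
  calc
    _ = |⟪(2 * ⟪u, v⟫) • u - v, w⟫ + ⟪u, v⟫ * ⟪u, w⟫| := by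
      rw [inner_sub_left, inner_smul_left]
      congr 1
      simp
      ring
    _ ≤ |⟪(2 * ⟪u, v⟫) • u - v, w⟫| + |⟪u, v⟫ * ⟪u, w⟫| := abs_add_le _ _
    _ ≤ _ := by linarith

/-- Symmetric second differences are controlled by the second derivative. -/
lemma norm_add_sub_two_smul_le_of_norm_fderiv_fderiv_le {E G : Type*} [NormedAddCommGroup E]
    [NormedSpace ℝ E] [NormedAddCommGroup G] [NormedSpace ℝ G] {F : E → G} {r z : E} {δ M : ℝ}
    (hF : ContDiffOn ℝ 2 F (ball r δ))
    (hM : ∀ y ∈ ball r δ, ‖fderiv ℝ (fderiv ℝ F) y‖ ≤ M) (hz : ‖z‖ < δ) :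
    ‖F (r + z) + F (r - z) - (2 : ℝ) • F r‖ ≤ M * ‖z‖ ^ 2 := by
  have hdiff : ∀ y ∈ ball r δ, HasFDerivAt F (fderiv ℝ F y) y := fun y hy =>
    ((hF.contDiffAt (isOpen_ball.mem_nhds hy)).differentiableAt (by norm_num)).hasFDerivAt
  have hdiff₂ : ∀ y ∈ ball r δ, DifferentiableAt ℝ (fderiv ℝ F) y := fun y hy =>
    ((hF.contDiffAt (isOpen_ball.mem_nhds hy)).fderiv_right (m := 1) (by norm_num)).differentiableAt
      (by norm_num)
  have hmem : ∀ t ∈ Set.Icc (0 : ℝ) 1, r + t • z ∈ ball r δ ∧ r - t • z ∈ ball r δ := by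
    intro t ht
    have : ‖t • z‖ < δ := by
      rw [norm_smul, Real.norm_eq_abs, abs_of_nonneg ht.1]
      exact (mul_le_of_le_one_left (norm_nonneg z) ht.2).trans_lt hz
    constructor <;> simpa [mem_ball_iff_norm, norm_neg] using this
  have hderiv : ∀ t ∈ Set.Icc (0 : ℝ) 1,
      HasDerivAt (fun t : ℝ => F (r + t • z) + F (r - t • z) - (2 : ℝ) • F r)
        (fderiv ℝ F (r + t • z) z - fderiv ℝ F (r - t • z) z) t := by
    intro t ht
    have hline : HasDerivAt (fun t : ℝ => t • z) z t := by
      simpa using (hasDerivAt_id t).smul_const z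
    have h₁ := (hdiff _ (hmem t ht).1).comp_hasDerivAt t (hline.const_add r)
    have h₂ := (hdiff _ (hmem t ht).2).comp_hasDerivAt t (hline.const_sub r)
    simpa [sub_eq_add_neg] using (h₁.add h₂).sub_const ((2 : ℝ) • F r)
  have hbound := image_norm_le_of_norm_deriv_right_le_deriv_boundary
    (B := fun t => M * ‖z‖ ^ 2 * t ^ 2) (B' := fun t => M * ‖z‖ ^ 2 * (2 * t))
    (fun t ht => (hderiv t ht).continuousAt.continuousWithinAt)
    (fun t ht => (hderiv t (Set.Ico_subset_Icc_self ht)).hasDerivWithinAt)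
    (by simp [two_smul])
    (fun t => by simpa using (hasDerivAt_pow 2 t).const_mul (M * ‖z‖ ^ 2))
    (fun t ht => by
      have ht' := Set.Ico_subset_Icc_self ht
      have hlip := (convex_ball r δ).norm_image_sub_le_of_norm_fderiv_le hdiff₂ hM
        (hmem t ht').2 (hmem t ht').1
      have hsub : r + t • z - (r - t • z) = (2 * t) • z := by module
      rw [hsub, norm_smul, Real.norm_eq_abs, abs_of_nonneg (by linarith [ht.1])] at hlip
      rw [← sub_apply]
      calc
        _ ≤ ‖fderiv ℝ F (r + t • z) - fderiv ℝ F (r - t • z)‖ * ‖z‖ :=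
          ContinuousLinearMap.le_opNorm _ _
        _ ≤ M * (2 * t * ‖z‖) * ‖z‖ := by gcongr
        _ = _ := by ring)
    (Set.right_mem_Icc.2 zero_le_one)
  simpa using hbound

lemma preimage_reflection_ball {E : Type*} [SeminormedAddCommGroup E] (r : E) (δ : ℝ) :
    (fun y => r + r - y) ⁻¹' ball r δ = ball r δ := by
  ext y
  rw [Set.mem_preimage, mem_ball_iff_norm, mem_ball_iff_norm,
    show r + r - y - r = -(y - r) by abel, norm_neg]

/-- Reflection through the centre preserves integrals over a ball. -/
lemma setIntegral_ball_comp_reflection {E G : Type*} [NormedAddCommGroup E] [MeasurableSpace E]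
    [BorelSpace E] [NormedSpace ℝ E] [FiniteDimensional ℝ E] {μ : Measure E}
    [μ.IsAddHaarMeasure] [NormedAddCommGroup G] [NormedSpace ℝ G]
    (f : E → G) (r : E) (δ : ℝ) :
    ∫ y in ball r δ, f (r + r - y) ∂μ = ∫ y in ball r δ, f y ∂μ := by
  have h := (Measure.measurePreserving_sub_left μ (r + r)).setIntegral_preimage_emb
    (MeasurableEquiv.subLeft (r + r)).measurableEmbedding f (ball r δ)
  rwa [preimage_reflection_ball] at h

lemma integrableOn_and_setIntegral_inv_norm_ball (r : EuclideanSpace ℝ (Fin 3)) {δ : ℝ}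
    (hδ : 0 < δ) :
    IntegrableOn (fun y => ‖y - r‖⁻¹) (ball r δ) ∧
      ∫ y in ball r δ, ‖y - r‖⁻¹ = 2 * π * δ ^ 2 := by
  let φ : ℝ → ℝ := (Set.Iio δ).indicator fun t => t⁻¹
  have hφ : (ball r δ).indicator (fun y => ‖y - r‖⁻¹) = fun y => φ ‖y - r‖ := by
    ext y
    classical simp only [φ, Set.indicator_apply, mem_ball_iff_norm, Set.mem_Iio]
  have hradial : Set.EqOn (fun t : ℝ => t ^ 2 • φ t) ((Set.Iio δ).indicator fun t => t)
      (Set.Ioi 0) := by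
    intro t ht
    have ht' : t ≠ 0 := ne_of_gt ht
    by_cases htδ : t < δ
    · simp [φ, htδ]
      field_simp
    · simp [φ, htδ]
  have hinter : Set.Ioi 0 ∩ Set.Iio δ = Set.Ioo 0 δ := Set.Ioi_inter_Iio
  constructor
  · rw [← integrable_indicator_iff measurableSet_ball, hφ]
    refine Integrable.comp_sub_right (f := fun y => φ ‖y‖) ?_ r
    rw [integrable_fun_norm_addHaar volume, finrank_euclideanSpace_fin,
      integrableOn_congr_fun hradial measurableSet_Ioi, IntegrableOn,
      integrable_indicator_iff measurableSet_Iio, IntegrableOn,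
      Measure.restrict_restrict measurableSet_Iio, Set.inter_comm, hinter]
    exact (continuous_id.integrableOn_Icc (a := 0) (b := δ)).mono_set Set.Ioo_subset_Icc_self
  · have hvol : volume.real (ball (0 : EuclideanSpace ℝ (Fin 3)) 1) = π * 4 / 3 := by
      rw [measureReal_def, EuclideanSpace.volume_ball_fin_three]
      simp [ENNReal.toReal_ofReal (by positivity : 0 ≤ π * 4 / 3)]
    rw [← integral_indicator measurableSet_ball, hφ,
      integral_sub_right_eq_self (fun y => φ ‖y‖) r, integral_fun_norm_addHaar volume,
      finrank_euclideanSpace_fin, setIntegral_congr_fun measurableSet_Ioi hradial,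
      setIntegral_indicator measurableSet_Iio, hinter, ← integral_Ioc_eq_integral_Ioo,
      ← intervalIntegral.integral_of_le hδ.le, integral_id, hvol]
    simp
    ring

theorem hypersingular_correction_sphere_improved_estimate
    (r : EuclideanSpace ℝ (Fin 3)) (δ : ℝ) (hδ : 0 < δ)
    (F : EuclideanSpace ℝ (Fin 3) → ℂ) (s : Set (EuclideanSpace ℝ (Fin 3)))
    (hs : IsOpen s) (hsub : Metric.closedBall r δ ⊆ s)
    (hF : ContDiffOn ℝ 2 F s) (M₂ : ℝ)
    (hM : ∀ y ∈ s, ‖fderiv ℝ (fderiv ℝ F) y‖ ≤ M₂)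
    (v w : EuclideanSpace ℝ (Fin 3)) (hv : ‖v‖ = 1) (hw : ‖w‖ = 1) :
    ‖∫ y in Metric.ball r δ,
        (((3 * ⟪‖y - r‖⁻¹ • (y - r), v⟫ * ⟪‖y - r‖⁻¹ • (y - r), w⟫ - ⟪v, w⟫) /
          (4 * π * ‖y - r‖ ^ 3) : ℝ) : ℂ) * (F y - F r)‖ ≤ (1 / 2) * M₂ * δ ^ 2 := by
  have hball : ball r δ ⊆ s := ball_subset_closedBall.trans hsub
  have hM₀ : 0 ≤ M₂ :=
    (norm_nonneg (fderiv ℝ (fderiv ℝ F) r)).trans (hM r (hsub (mem_closedBall_self hδ.le)))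
  set K : EuclideanSpace ℝ (Fin 3) → ℝ := fun z =>
    (3 * ⟪‖z‖⁻¹ • z, v⟫ * ⟪‖z‖⁻¹ • z, w⟫ - ⟪v, w⟫) / (4 * π * ‖z‖ ^ 3) with hK
  have hKneg : ∀ z, K (-z) = K z := fun z => by simp [hK]
  have hKbound : ∀ z, |K z| * ‖z‖ ^ 2 ≤ (2 * π)⁻¹ * ‖z‖⁻¹ := by
    intro z
    rcases eq_or_ne z 0 with rfl | hz
    · simp
    have hz' : 0 < ‖z‖ := norm_pos_iff.2 hz
    have hnum := abs_three_mul_inner_mul_inner_sub_le (norm_smul_inv_norm (𝕜 := ℝ) hz) v w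
    simp only [RCLike.ofReal_real_eq_id, id, hv, hw, mul_one] at hnum
    rw [hK, abs_div, abs_of_pos (by positivity : 0 < 4 * π * ‖z‖ ^ 3)]
    calc
      _ ≤ 2 / (4 * π * ‖z‖ ^ 3) * ‖z‖ ^ 2 := by gcongr
      _ = _ := by field_simp; norm_num
  set f : EuclideanSpace ℝ (Fin 3) → ℂ := fun y => (K (y - r) : ℂ) * (F y - F r) with hf
  change ‖∫ y in ball r δ, f y‖ ≤ _
  by_cases hint : IntegrableOn f (ball r δ)
  swap
  · rw [integral_undef hint, norm_zero]
    positivity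
  have hint' : IntegrableOn (fun y => f (r + r - y)) (ball r δ) := by
    have h := ((Measure.measurePreserving_sub_left volume (r + r)).integrableOn_comp_preimage
      (MeasurableEquiv.subLeft (r + r)).measurableEmbedding).2 hint
    rwa [preimage_reflection_ball] at h
  have hsym : ∫ y in ball r δ, f y + f (r + r - y) = 2 * ∫ y in ball r δ, f y := by
    rw [integral_add hint hint', setIntegral_ball_comp_reflection, two_mul]
  obtain ⟨hg, hgval⟩ := integrableOn_and_setIntegral_inv_norm_ball r hδ
  have hle : ‖∫ y in ball r δ, f y + f (r + r - y)‖ ≤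
      ∫ y in ball r δ, M₂ * (2 * π)⁻¹ * ‖y - r‖⁻¹ := by
    refine norm_integral_le_of_norm_le (hg.const_mul _) ?_
    filter_upwards [ae_restrict_mem measurableSet_ball] with y hy
    have hsecond := norm_add_sub_two_smul_le_of_norm_fderiv_fderiv_le (hF.mono hball)
      (fun y hy => hM y (hball hy)) (mem_ball_iff_norm.1 hy)
    have hsum : f y + f (r + r - y) = (K (y - r) : ℂ) *
        (F (r + (y - r)) + F (r - (y - r)) - (2 : ℝ) • F r) := by
      simp only [hf]
      rw [show r + r - y - r = -(y - r) by abel, hKneg, show r + (y - r) = y by abel,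
        show r - (y - r) = r + r - y by abel, two_smul]
      ring
    rw [hsum, norm_mul, Complex.norm_real, Real.norm_eq_abs]
    calc
      _ ≤ |K (y - r)| * (M₂ * ‖y - r‖ ^ 2) := by gcongr
      _ = M₂ * (|K (y - r)| * ‖y - r‖ ^ 2) := by ring
      _ ≤ M₂ * ((2 * π)⁻¹ * ‖y - r‖⁻¹) := mul_le_mul_of_nonneg_left (hKbound _) hM₀
      _ = _ := by ring
  rw [hsym, norm_mul, integral_const_mul, hgval] at hle
  have hval : M₂ * (2 * π)⁻¹ * (2 * π * δ ^ 2) = M₂ * δ ^ 2 := by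
    field_simp
  rw [hval] at hle
  norm_num at hle
  linarith
end

section
/- Let k ∈ ℝ with k ≠ 0. There exists a constant C > 0 (depending only on k) such that for all y with 0 < ‖y‖ ≤ 1 and all unit vectors v, w ∈ ℝ³, writing u = y/‖y‖: |g(y)⟨v, w⟩ + k⁻²·D²g(y)(v, w) + (⟨v, w⟩ − 3⟨u, v⟩⟨u, w⟩)/(4πk²‖y‖³)| ≤ C/‖y‖²; i.e., the dyadic Green's function G_E(y) equals its leading hyper-singular part (3u⊗u − I)/(4πk²‖y‖³) up to an error of order O(1/‖y‖²) as y → 0. -/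
open MeasureTheory Metric Real RealInnerProductSpace

noncomputable def gHelm (k : ℝ) (y : EuclideanSpace ℝ (Fin 3)) : ℂ :=
  Complex.exp (-Complex.I * k * ‖y‖) / (4 * π * ‖y‖)

theorem HasDerivAt.hasFDerivAt_comp_norm {E G : Type*} [NormedAddCommGroup E]
    [InnerProductSpace ℝ E] [NormedAddCommGroup G] [NormedSpace ℝ G] {F : ℝ → G} {F' : G} {y : E}
    (hy : y ≠ 0) (hF : HasDerivAt F F' ‖y‖) :
    HasFDerivAt (fun z => F ‖z‖) ((innerSL ℝ y).smulRight (‖y‖⁻¹ • F')) y := by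
  have hr : ‖y‖ ≠ 0 := norm_ne_zero_iff.mpr hy
  have hsq := (hasStrictFDerivAt_norm_sq y).hasFDerivAt.sqrt (pow_ne_zero 2 hr)
  simp only [Real.sqrt_sq (norm_nonneg _)] at hsq
  refine (hF.hasFDerivAt.comp y hsq).congr_fderiv ?_
  ext w
  simp [two_smul, smul_smul]
  module

/-- The second derivative of a radial function `f ‖y‖`, in terms of `h r = r⁻¹ • deriv f r`. -/
theorem fderiv_fderiv_comp_norm_apply {E G : Type*} [NormedAddCommGroup E]
    [InnerProductSpace ℝ E] [NormedAddCommGroup G] [NormedSpace ℝ G] {f h : ℝ → G} {h' : G} {y : E}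
    (hy : y ≠ 0) (hf : ∀ r, 0 < r → HasDerivAt f (r • h r) r) (hh : HasDerivAt h h' ‖y‖) (v w : E) :
    fderiv ℝ (fderiv ℝ fun z => f ‖z‖) y v w =
      ⟪v, w⟫ • h ‖y‖ + (⟪y, v⟫ * ⟪y, w⟫) • ‖y‖⁻¹ • h' := by
  have hfd : fderiv ℝ (fun z : E => f ‖z‖) =ᶠ[nhds y]
      fun z => (innerSL ℝ z).smulRight (h ‖z‖) := by
    filter_upwards [isOpen_ne.mem_nhds hy] with z hz
    rw [((hf _ (norm_pos_iff.mpr hz)).hasFDerivAt_comp_norm hz).fderiv, smul_smul,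
      inv_mul_cancel₀ (norm_ne_zero_iff.mpr hz), one_smul]
  have hd := (ContinuousLinearMap.smulRightL ℝ E G).hasFDerivAt_of_bilinear
    (innerSL ℝ (E := E)).hasFDerivAt (hh.hasFDerivAt_comp_norm hy)
  have hd' : HasFDerivAt (fun z : E => (innerSL ℝ z).smulRight (h ‖z‖)) _ y := hd
  rw [hfd.fderiv_eq, hd'.fderiv]
  change ⟪y, w⟫ • ⟪y, v⟫ • ‖y‖⁻¹ • h' + ⟪v, w⟫ • h ‖y‖ = _
  module

theorem hasDerivAt_exp_div (k : ℝ) {r : ℝ} (hr : r ≠ 0) :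
    HasDerivAt (fun s : ℝ => Complex.exp (-Complex.I * k * s) / (4 * π * s))
      (r • (Complex.exp (-Complex.I * k * r) * (-Complex.I * k * r - 1) / (4 * π * r ^ 3))) r := by
  have hr' : (r : ℂ) ≠ 0 := by exact_mod_cast hr
  have hπ : (π : ℂ) ≠ 0 := by exact_mod_cast Real.pi_ne_zero
  have hs : HasDerivAt (fun s : ℝ => (s : ℂ)) 1 r := Complex.ofRealCLM.hasDerivAt
  refine ((hs.const_mul (-Complex.I * k)).cexp.div (hs.const_mul (4 * π : ℂ))
    (by simp [hr, hπ])).congr_deriv ?_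
  rw [Complex.real_smul]
  field_simp

theorem hasDerivAt_exp_mul_div (k : ℝ) {r : ℝ} (hr : r ≠ 0) :
    HasDerivAt (fun s : ℝ =>
        Complex.exp (-Complex.I * k * s) * (-Complex.I * k * s - 1) / (4 * π * s ^ 3))
      (Complex.exp (-Complex.I * k * r) * (-k ^ 2 * r ^ 2 + 3 * Complex.I * k * r + 3) /
        (4 * π * r ^ 4)) r := by
  have hr' : (r : ℂ) ≠ 0 := by exact_mod_cast hr
  have hπ : (π : ℂ) ≠ 0 := by exact_mod_cast Real.pi_ne_zero
  have hs : HasDerivAt (fun s : ℝ => (s : ℂ)) 1 r := Complex.ofRealCLM.hasDerivAt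
  have hl := hs.const_mul (-Complex.I * k)
  refine ((hl.cexp.mul (hl.sub_const 1)).div ((hs.pow 3).const_mul (4 * π : ℂ))
    (by simp [hr', hπ])).congr_deriv ?_
  simp
  field_simp
  linear_combination (k ^ 2 * r ^ 2 : ℂ) * Complex.I_sq

theorem fderiv_fderiv_gHelm_apply (k : ℝ) {y : EuclideanSpace ℝ (Fin 3)} (hy : y ≠ 0)
    (v w : EuclideanSpace ℝ (Fin 3)) :
    fderiv ℝ (fderiv ℝ (gHelm k)) y v w =
      ⟪v, w⟫ • (Complex.exp (-Complex.I * k * ‖y‖) * (-Complex.I * k * ‖y‖ - 1) /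
        (4 * π * ‖y‖ ^ 3)) +
      (⟪y, v⟫ * ⟪y, w⟫) • ‖y‖⁻¹ • (Complex.exp (-Complex.I * k * ‖y‖) *
        (-k ^ 2 * ‖y‖ ^ 2 + 3 * Complex.I * k * ‖y‖ + 3) / (4 * π * ‖y‖ ^ 4)) :=
  fderiv_fderiv_comp_norm_apply hy (fun _ hr => hasDerivAt_exp_div k hr.ne')
    (hasDerivAt_exp_mul_div k (norm_ne_zero_iff.mpr hy)) v w

theorem dyadic_green_function_leading_singularity
    (k : ℝ) (hk : k ≠ 0) :
    ∃ C : ℝ, 0 < C ∧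
      ∀ y : EuclideanSpace ℝ (Fin 3), 0 < ‖y‖ → ‖y‖ ≤ 1 →
        ∀ v w : EuclideanSpace ℝ (Fin 3), ‖v‖ = 1 → ‖w‖ = 1 →
          ‖gHelm k y * (⟪v, w⟫ : ℝ) +
              ((k : ℂ) ^ 2)⁻¹ * fderiv ℝ (fderiv ℝ (gHelm k)) y v w +
              (((⟪v, w⟫ - 3 * ⟪‖y‖⁻¹ • y, v⟫ * ⟪‖y‖⁻¹ • y, w⟫) /
                (4 * π * k ^ 2 * ‖y‖ ^ 3) : ℝ) : ℂ)‖ ≤ C / ‖y‖ ^ 2 := by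
  refine ⟨(2 * k ^ 2 + 8 * |k|) / (4 * π * k ^ 2), by positivity, fun y hr hr1 v w hv hw => ?_⟩
  have hy : y ≠ 0 := norm_pos_iff.mp hr
  have hu : ‖‖y‖⁻¹ • y‖ = 1 := norm_smul_inv_norm hy
  have hyu : y = ‖y‖ • ‖y‖⁻¹ • y := (smul_inv_smul₀ hr.ne' y).symm
  have hin : ∀ z, ⟪y, z⟫ = ‖y‖ * ⟪‖y‖⁻¹ • y, z⟫ := fun z => by
    rw [← real_inner_smul_left, ← hyu]
  rw [fderiv_fderiv_gHelm_apply k hy, hin v, hin w]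
  have ha : |⟪v, w⟫| ≤ 1 := (abs_real_inner_le_norm v w).trans_eq (by simp [hv, hw])
  have hp : |⟪‖y‖⁻¹ • y, v⟫| ≤ 1 := (abs_real_inner_le_norm _ v).trans_eq (by simp [hu, hv])
  have hq : |⟪‖y‖⁻¹ • y, w⟫| ≤ 1 := (abs_real_inner_le_norm _ w).trans_eq (by simp [hu, hw])
  unfold gHelm
  generalize ⟪v, w⟫ = a at *
  generalize ⟪‖y‖⁻¹ • y, v⟫ = p at *
  generalize ⟪‖y‖⁻¹ • y, w⟫ = q at *
  clear hin hyu hu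
  generalize ‖y‖ = r at *
  have he : ‖Complex.exp (-Complex.I * k * r)‖ = 1 := by
    convert Complex.norm_exp_ofReal_mul_I (-(k * r)) using 3
    push_cast
    ring
  have he1 : ‖Complex.exp (-Complex.I * k * r) - 1‖ ≤ |k| * r := by
    have h := Real.norm_exp_I_mul_ofReal_sub_one_le (x := -(k * r))
    rw [norm_neg, norm_mul, Real.norm_eq_abs, Real.norm_eq_abs, abs_of_pos hr] at h
    convert h using 4
    push_cast
    ring
  generalize Complex.exp (-Complex.I * k * r) = e at *
  have hr' : (r : ℂ) ≠ 0 := by exact_mod_cast hr.ne'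
  have hk' : (k : ℂ) ≠ 0 := by exact_mod_cast hk
  have hπ : (π : ℂ) ≠ 0 := by exact_mod_cast Real.pi_ne_zero
  have hkr : k ^ 2 * r ^ 2 ≤ k ^ 2 * r := by
    gcongr
    nlinarith
  have hA : ‖(k ^ 2 * r ^ 2 - Complex.I * k * r : ℂ) * e - (e - 1)‖ ≤ (k ^ 2 + 2 * |k|) * r := by
    have h1 : ‖(k ^ 2 * r ^ 2 : ℂ)‖ = k ^ 2 * r ^ 2 := by simp
    have h2 : ‖(Complex.I * k * r : ℂ)‖ = |k| * r := by simp [abs_of_pos hr]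
    have h3 := norm_sub_le (k ^ 2 * r ^ 2 : ℂ) (Complex.I * k * r)
    have h4 := norm_sub_le ((k ^ 2 * r ^ 2 - Complex.I * k * r : ℂ) * e) (e - 1)
    rw [norm_mul, he, mul_one] at h4
    linarith
  have hB : ‖(-k ^ 2 * r ^ 2 + 3 * Complex.I * k * r : ℂ) * e + 3 * (e - 1)‖ ≤
      (k ^ 2 + 6 * |k|) * r := by
    have h1 : ‖(-k ^ 2 * r ^ 2 : ℂ)‖ = k ^ 2 * r ^ 2 := by simp
    have h2 : ‖(3 * Complex.I * k * r : ℂ)‖ = 3 * |k| * r := by simp [abs_of_pos hr]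
    have h3 := norm_add_le (-k ^ 2 * r ^ 2 : ℂ) (3 * Complex.I * k * r)
    have h4 := norm_add_le ((-k ^ 2 * r ^ 2 + 3 * Complex.I * k * r : ℂ) * e) (3 * (e - 1))
    rw [norm_mul, he, mul_one, norm_mul, RCLike.norm_ofNat] at h4
    linarith
  calc
    _ = ‖(a * ((k ^ 2 * r ^ 2 - Complex.I * k * r) * e - (e - 1)) +
          p * q * ((-k ^ 2 * r ^ 2 + 3 * Complex.I * k * r) * e + 3 * (e - 1))) /
          ((4 * π * k ^ 2 * r ^ 3 : ℝ) : ℂ)‖ := by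
      congr 1
      simp only [Complex.real_smul]
      push_cast
      field_simp
      ring
    _ ≤ ((k ^ 2 + 2 * |k|) * r + (k ^ 2 + 6 * |k|) * r) / (4 * π * k ^ 2 * r ^ 3) := by
      rw [norm_div, Complex.norm_of_nonneg (by positivity)]
      gcongr
      refine (norm_add_le _ _).trans (add_le_add ?_ ?_)
      · rw [norm_mul, Complex.norm_real]
        exact (mul_le_of_le_one_left (norm_nonneg _) ha).trans hA
      · rw [norm_mul, norm_mul, Complex.norm_real, Complex.norm_real]
        exact (mul_le_of_le_one_left (norm_nonneg _)
          (mul_le_one₀ hp (norm_nonneg _) hq)).trans hB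
    _ = _ := by
      field_simp
      ring
end

section
/- Let F : ℝ³ → ℂ be Lipschitz on the closed unit ball, and let v, w ∈ ℝ³. Then the function y ↦ K(y)(v, w)·(F(y) − F(0)) is integrable on the open unit ball, and the Cauchy principal value exists: the truncated integrals I(δ) = ∫_{δ < ‖y‖ < 1} (3⟨û, v⟩⟨û, w⟩ − ⟨v, w⟩)/(4π‖y‖³) · F(y) dy converge, as δ → 0⁺, to ∫_{0 < ‖y‖ < 1} (3⟨û, v⟩⟨û, w⟩ − ⟨v, w⟩)/(4π‖y‖³) · (F(y) − F(0)) dy. -/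
open MeasureTheory Metric Real RealInnerProductSpace Filter Topology

/-- The hypersingular kernel `(3 û ⊗ û - I) / (4π‖y‖³)`, `û = y / ‖y‖`, as a bilinear form in
`v` and `w`. -/
noncomputable def hypersingularKernel (v w y : EuclideanSpace ℝ (Fin 3)) : ℝ :=
  (3 * ⟪‖y‖⁻¹ • y, v⟫ * ⟪‖y‖⁻¹ • y, w⟫ - ⟪v, w⟫) / (4 * π * ‖y‖ ^ 3)

/-- The open spherical shell of radii `δ` and `1` centred at the origin. -/
def openShell (δ : ℝ) : Set (EuclideanSpace ℝ (Fin 3)) := {y | δ < ‖y‖ ∧ ‖y‖ < 1}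

lemma measurableSet_openShell (δ : ℝ) : MeasurableSet (openShell δ) :=
  (measurableSet_lt measurable_const measurable_norm).inter
    (measurableSet_lt measurable_norm measurable_const)

lemma openShell_subset_ball (δ : ℝ) : openShell δ ⊆ ball 0 1 :=
  fun _ hy => mem_ball_zero_iff.2 hy.2

lemma measurable_hypersingularKernel (v w : EuclideanSpace ℝ (Fin 3)) :
    Measurable (hypersingularKernel v w) := by
  unfold hypersingularKernel
  fun_prop

lemma norm_hypersingularKernel_le (v w y : EuclideanSpace ℝ (Fin 3)) :
    ‖hypersingularKernel v w y‖ ≤ ‖v‖ * ‖w‖ / (π * ‖y‖ ^ 3) := by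
  rcases eq_or_ne y 0 with rfl | hy
  · simp [hypersingularKernel]
  have hy' : 0 < ‖y‖ := norm_pos_iff.2 hy
  have hu : ‖‖y‖⁻¹ • y‖ = 1 := by
    rw [norm_smul, norm_inv, norm_norm, inv_mul_cancel₀ hy'.ne']
  have h1 := abs_real_inner_le_norm (‖y‖⁻¹ • y) v
  have h2 := abs_real_inner_le_norm (‖y‖⁻¹ • y) w
  have h3 := abs_real_inner_le_norm v w
  rw [hu, one_mul] at h1 h2
  have h4 : |⟪‖y‖⁻¹ • y, v⟫ * ⟪‖y‖⁻¹ • y, w⟫| ≤ ‖v‖ * ‖w‖ := by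
    rw [abs_mul]
    gcongr
  have hnum : |3 * ⟪‖y‖⁻¹ • y, v⟫ * ⟪‖y‖⁻¹ • y, w⟫ - ⟪v, w⟫| ≤ 4 * (‖v‖ * ‖w‖) := by
    rw [mul_assoc]
    rw [abs_le] at h3 h4 ⊢
    constructor <;> linarith
  rw [hypersingularKernel, Real.norm_eq_abs, abs_div,
    abs_of_pos (show 0 < 4 * π * ‖y‖ ^ 3 by positivity), mul_assoc 4 π,
    ← mul_div_mul_left (‖v‖ * ‖w‖) _ (four_ne_zero' ℝ)]
  gcongr

lemma integrableOn_hypersingularKernel_openShell (v w : EuclideanSpace ℝ (Fin 3)) {δ : ℝ}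
    (hδ : 0 < δ) : IntegrableOn (hypersingularKernel v w) (openShell δ) := by
  refine Measure.integrableOn_of_bounded (M := ‖v‖ * ‖w‖ / (π * δ ^ 3))
    (measure_ne_top_of_subset (openShell_subset_ball δ) measure_ball_lt_top.ne)
    (measurable_hypersingularKernel v w).aestronglyMeasurable ?_
  filter_upwards [ae_restrict_mem (measurableSet_openShell δ)] with y hy
  refine (norm_hypersingularKernel_le v w y).trans ?_
  have := hy.1
  gcongr

lemma hypersingularKernel_map (e : EuclideanSpace ℝ (Fin 3) ≃ₗᵢ[ℝ] EuclideanSpace ℝ (Fin 3))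
    (v w y : EuclideanSpace ℝ (Fin 3)) :
    hypersingularKernel (e v) (e w) (e y) = hypersingularKernel v w y := by
  simp only [hypersingularKernel, e.norm_map, ← map_smul, e.inner_map_map]

lemma setIntegral_hypersingularKernel_map
    (e : EuclideanSpace ℝ (Fin 3) ≃ₗᵢ[ℝ] EuclideanSpace ℝ (Fin 3))
    (v w : EuclideanSpace ℝ (Fin 3)) (δ : ℝ) :
    ∫ y in openShell δ, hypersingularKernel (e v) (e w) y =
      ∫ y in openShell δ, hypersingularKernel v w y := by
  rw [← e.measurePreserving.setIntegral_preimage_emb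
    e.toHomeomorph.toMeasurableEquiv.measurableEmbedding]
  have : e ⁻¹' openShell δ = openShell δ := by
    ext y
    simp [openShell]
  simp only [this, hypersingularKernel_map]

lemma sum_hypersingularKernel_basisFun {y : EuclideanSpace ℝ (Fin 3)} (hy : y ≠ 0) (c : ℝ) :
    ∑ i, hypersingularKernel (c • EuclideanSpace.basisFun (Fin 3) ℝ i)
      (c • EuclideanSpace.basisFun (Fin 3) ℝ i) y = 0 := by
  have hy' : ‖y‖ ≠ 0 := norm_ne_zero_iff.2 hy
  have h := EuclideanSpace.real_norm_sq_eq y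
  simp only [Fin.sum_univ_three] at h
  simp only [hypersingularKernel, ← Finset.sum_div, Fin.sum_univ_three, inner_smul_left,
    inner_smul_right, EuclideanSpace.basisFun_apply, EuclideanSpace.inner_single_right,
    PiLp.single_apply]
  rw [div_eq_zero_iff]
  left
  simp
  field_simp
  linear_combination (-3 * c ^ 2) * h

lemma setIntegral_hypersingularKernel_self (v : EuclideanSpace ℝ (Fin 3)) {δ : ℝ} (hδ : 0 < δ) :
    ∫ y in openShell δ, hypersingularKernel v v y = 0 := by
  set b := EuclideanSpace.basisFun (Fin 3) ℝ
  have hb (i : Fin 3) : ∫ y in openShell δ, hypersingularKernel (‖v‖ • b i) (‖v‖ • b i) y =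
      ∫ y in openShell δ, hypersingularKernel v v y := by
    have h := Submodule.reflection_sub (v := v) (w := ‖v‖ • b i) (by simp [norm_smul])
    rw [← h, setIntegral_hypersingularKernel_map]
  have hsum : ∑ i, ∫ y in openShell δ, hypersingularKernel (‖v‖ • b i) (‖v‖ • b i) y = 0 := by
    rw [← integral_finsetSum _
      fun i _ => integrableOn_hypersingularKernel_openShell (‖v‖ • b i) (‖v‖ • b i) hδ]
    refine setIntegral_eq_zero_of_forall_eq_zero fun y hy => ?_
    exact sum_hypersingularKernel_basisFun (norm_pos_iff.1 (hδ.trans hy.1)) ‖v‖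
  simp only [hb, Finset.sum_const, Finset.card_univ, Fintype.card_fin] at hsum
  simpa using hsum

lemma hypersingularKernel_polarization (v w y : EuclideanSpace ℝ (Fin 3)) :
    hypersingularKernel v w y = (1 / 4) *
      (hypersingularKernel (v + w) (v + w) y - hypersingularKernel (v - w) (v - w) y) := by
  simp only [hypersingularKernel, inner_add_left, inner_add_right, inner_sub_left,
    inner_sub_right, real_inner_comm v w]
  ring

/-- The hypersingular kernel has mean zero on spherical shells. -/
lemma setIntegral_hypersingularKernel (v w : EuclideanSpace ℝ (Fin 3)) {δ : ℝ} (hδ : 0 < δ) :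
    ∫ y in openShell δ, hypersingularKernel v w y = 0 := by
  simp only [hypersingularKernel_polarization v w]
  rw [integral_const_mul, integral_sub (integrableOn_hypersingularKernel_openShell _ _ hδ)
    (integrableOn_hypersingularKernel_openShell _ _ hδ),
    setIntegral_hypersingularKernel_self _ hδ, setIntegral_hypersingularKernel_self _ hδ]
  simp

lemma integrableOn_hypersingularKernel_mul_sub {F : EuclideanSpace ℝ (Fin 3) → ℂ} {L : NNReal}
    (hF : LipschitzOnWith L F (closedBall 0 1)) (v w : EuclideanSpace ℝ (Fin 3)) :
    IntegrableOn (fun y => (hypersingularKernel v w y : ℂ) * (F y - F 0)) (ball 0 1) := by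
  have hmeas : AEStronglyMeasurable F (volume.restrict (ball 0 1)) :=
    (hF.continuousOn.mono ball_subset_closedBall).aestronglyMeasurable measurableSet_ball
  have hdom : IntegrableOn
      (fun y : EuclideanSpace ℝ (Fin 3) => ‖v‖ * ‖w‖ / π * L * ‖y‖ ^ (-2 : ℝ)) (ball 0 1) := by
    refine integrableOn_ball_of_norm_le_rpow (C := ‖v‖ * ‖w‖ / π * L) (α := 2)
      (by simp) (by simp; norm_num) (ae_of_all _ fun y => ?_)
      (Measurable.aestronglyMeasurable (by fun_prop))
    rw [Real.norm_of_nonneg (by positivity)]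
  refine Integrable.mono' hdom ?_ ?_
  · exact (Complex.measurable_ofReal.comp
      (measurable_hypersingularKernel v w)).aestronglyMeasurable.mul
      (hmeas.sub aestronglyMeasurable_const)
  · filter_upwards [ae_restrict_mem measurableSet_ball] with y hy
    have hFy : ‖F y - F 0‖ ≤ L * ‖y‖ := by
      simpa [dist_eq_norm] using hF.dist_le_mul y (ball_subset_closedBall hy) 0 (by simp)
    rw [norm_mul, Complex.norm_real]
    calc ‖hypersingularKernel v w y‖ * ‖F y - F 0‖
        ≤ ‖v‖ * ‖w‖ / (π * ‖y‖ ^ 3) * (L * ‖y‖) := by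
          gcongr
          exact norm_hypersingularKernel_le v w y
      _ = ‖v‖ * ‖w‖ / π * L * ‖y‖ ^ (-2 : ℝ) := by
          rw [Real.rpow_neg (norm_nonneg y), Real.rpow_two]
          rcases eq_or_ne ‖y‖ 0 with h | h
          · simp [h]
          · field_simp

lemma setIntegral_hypersingularKernel_mul {F : EuclideanSpace ℝ (Fin 3) → ℂ} {L : NNReal}
    (hF : LipschitzOnWith L F (closedBall 0 1)) (v w : EuclideanSpace ℝ (Fin 3)) {δ : ℝ}
    (hδ : 0 < δ) :
    ∫ y in openShell δ, (hypersingularKernel v w y : ℂ) * F y =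
      ∫ y in openShell δ, (hypersingularKernel v w y : ℂ) * (F y - F 0) := by
  have hconst : IntegrableOn (fun y => (hypersingularKernel v w y : ℂ) * F 0) (openShell δ) :=
    (integrableOn_hypersingularKernel_openShell v w hδ).ofReal.mul_const (F 0)
  calc ∫ y in openShell δ, (hypersingularKernel v w y : ℂ) * F y
      = ∫ y in openShell δ, ((hypersingularKernel v w y : ℂ) * (F y - F 0) +
          (hypersingularKernel v w y : ℂ) * F 0) := by simp only [mul_sub, sub_add_cancel]
    _ = _ := by
      rw [integral_add ((integrableOn_hypersingularKernel_mul_sub hF v w).mono_set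
        (openShell_subset_ball δ)) hconst, integral_mul_const, integral_complex_ofReal,
        setIntegral_hypersingularKernel v w hδ]
      simp

lemma tendsto_setIntegral_openShell {f : EuclideanSpace ℝ (Fin 3) → ℂ}
    (hf : IntegrableOn f (openShell 0)) :
    Tendsto (fun δ => ∫ y in openShell δ, f y) (𝓝[>] 0) (𝓝 (∫ y in openShell 0, f y)) := by
  have hcover : AECover (volume.restrict (openShell 0)) (𝓝[>] (0 : ℝ)) openShell := by
    refine ⟨?_, measurableSet_openShell⟩
    filter_upwards [ae_restrict_mem (measurableSet_openShell 0)] with y hy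
    filter_upwards [nhdsWithin_le_nhds (Iio_mem_nhds hy.1)] with δ hδ
    exact ⟨hδ, hy.2⟩
  refine (hcover.integral_tendsto_of_countably_generated hf).congr' ?_
  filter_upwards [self_mem_nhdsWithin] with δ hδ
  have hsub : openShell δ ⊆ openShell 0 := fun y hy => ⟨lt_trans hδ hy.1, hy.2⟩
  rw [Measure.restrict_restrict_of_subset hsub]

theorem hypersingular_principal_value_exists
    (F : EuclideanSpace ℝ (Fin 3) → ℂ) (L : NNReal)
    (hF : LipschitzOnWith L F (Metric.closedBall 0 1))
    (v w : EuclideanSpace ℝ (Fin 3)) :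
    IntegrableOn
      (fun y : EuclideanSpace ℝ (Fin 3) =>
        (((3 * ⟪‖y‖⁻¹ • y, v⟫ * ⟪‖y‖⁻¹ • y, w⟫ - ⟪v, w⟫) / (4 * π * ‖y‖ ^ 3) : ℝ) : ℂ) *
          (F y - F 0))
      (Metric.ball 0 1) volume ∧
    Tendsto
      (fun δ : ℝ =>
        ∫ y in {y : EuclideanSpace ℝ (Fin 3) | δ < ‖y‖ ∧ ‖y‖ < 1},
          (((3 * ⟪‖y‖⁻¹ • y, v⟫ * ⟪‖y‖⁻¹ • y, w⟫ - ⟪v, w⟫) / (4 * π * ‖y‖ ^ 3) : ℝ) : ℂ) *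
            F y)
      (𝓝[>] 0)
      (𝓝 (∫ y in {y : EuclideanSpace ℝ (Fin 3) | 0 < ‖y‖ ∧ ‖y‖ < 1},
          (((3 * ⟪‖y‖⁻¹ • y, v⟫ * ⟪‖y‖⁻¹ • y, w⟫ - ⟪v, w⟫) / (4 * π * ‖y‖ ^ 3) : ℝ) : ℂ) *
            (F y - F 0))) := by
  have hint := integrableOn_hypersingularKernel_mul_sub hF v w
  refine ⟨hint, (tendsto_setIntegral_openShell
    (hint.mono_set (openShell_subset_ball 0))).congr' ?_⟩
  filter_upwards [self_mem_nhdsWithin] with δ hδ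
  exact (setIntegral_hypersingularKernel_mul hF v w hδ).symm
end
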